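/- arXiv:1212.5207 — 7 statements merged into one kernel-verified Lean document; each statement's English description precedes it below -/
import Mathlib

section
/- Let G be a group generated by a finite symmetric set S ⊆ G, and let r ∈ ℕ. Let (V,E) be a finite S-labeled directed graph, i.e. E ⊆ V × S × V, and let d denote the graph distance on V obtained by forgetting directions and labels. Suppose v, w ∈ V are such that there exist labeled-graph isomorphisms ψ_v and ψ_w from the balls {u ∈ V : d(u,v) ≤ r}, resp. {u ∈ V : d(u,w) ≤ r}, onto the ball B_r^G = {g ∈ G : g is a product of at most r elements of S} of the labeled Cayley graph of (G,S); that is, ψ_v is a bijection onto B_r^G with ψ_v(v) = 1 such that for all u, u' in its domain and all s ∈ S one has (u,s,u') ∈ E if and only if ψ_v(u)·ψ_v(u')⁻¹ = s, and analogously for ψ_w. If x, y ∈ V satisfy 2·d(x,v) ≤ r, 2·d(y,v) ≤ r, 2·d(x,w) ≤ r and 2·d(y,w) ≤ r, then ψ_v(x)·ψ_v(y)⁻¹ = ψ_w(x)·ψ_w(y)⁻¹. -/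
/-- The ball of radius `r` around the identity in the Cayley graph of `(G,S)`:
elements expressible as products of at most `r` elements of `S`. -/
def cayleyBall {G : Type*} [Group G] (S : Set G) (r : ℕ) : Set G :=
  {g | ∃ l : List G, l.length ≤ r ∧ (∀ x ∈ l, x ∈ S) ∧ l.prod = g}

/-- Two group-valued vertex maps with the same quotient across every edge inside `A` have the
same quotient along any walk supported in `A`. -/
theorem SimpleGraph.Walk.mul_inv_eq_of_forall_adj {V G : Type*} [Group G] {Γ : SimpleGraph V}
    {A : Set V} {f g : V → G}
    (h : ∀ u ∈ A, ∀ u' ∈ A, Γ.Adj u u' → f u * (f u')⁻¹ = g u * (g u')⁻¹)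
    {a b : V} (p : Γ.Walk a b) (hp : ∀ u ∈ p.support, u ∈ A) :
    f a * (f b)⁻¹ = g a * (g b)⁻¹ := by
  induction p with
  | nil => simp
  | @cons a c b hadj q ih =>
    have hq : ∀ u ∈ q.support, u ∈ A := fun u hu => hp u (by simp [hu])
    have hac := h a (hp a (by simp)) c (hq c q.start_mem_support) hadj
    calc f a * (f b)⁻¹ = (f a * (f c)⁻¹) * (f c * (f b)⁻¹) := by group
      _ = (g a * (g c)⁻¹) * (g c * (g b)⁻¹) := by rw [hac, ih hq]
      _ = g a * (g b)⁻¹ := by group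

/-- If `x` lies within distance `r / 2` of both `v` and `w`, some walk from `x` to `v` stays
inside both `r`-balls. -/
theorem SimpleGraph.exists_walk_support_subset_balls {V : Type*} {Γ : SimpleGraph V} {r : ℕ}
    {x v w : V} (hv : Γ.Reachable x v ∧ 2 * Γ.dist x v ≤ r)
    (hw : Γ.Reachable x w ∧ 2 * Γ.dist x w ≤ r) :
    ∃ p : Γ.Walk x v, ∀ u ∈ p.support,
      (Γ.Reachable u v ∧ Γ.dist u v ≤ r) ∧ (Γ.Reachable u w ∧ Γ.dist u w ≤ r) := by
  classical
  obtain ⟨p, hp⟩ := hv.1.exists_walk_length_eq_dist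
  obtain ⟨q, hq⟩ := hw.1.exists_walk_length_eq_dist
  refine ⟨p, fun u hu => ?_⟩
  have h₁ := p.length_takeUntil_le_length hu
  have h₂ := p.length_dropUntil_le_length hu
  have h₃ := SimpleGraph.dist_le (p.dropUntil u hu)
  have h₄ := SimpleGraph.dist_le ((p.takeUntil u hu).reverse.append q)
  rw [SimpleGraph.Walk.length_append, SimpleGraph.Walk.length_reverse] at h₄
  exact ⟨⟨(p.dropUntil u hu).reachable, by omega⟩,
    ⟨((p.takeUntil u hu).reverse.append q).reachable, by omega⟩⟩

/-- In a finite S-labeled directed graph (V,E), if the r-balls (w.r.t. the graph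
distance of the underlying undirected unlabeled graph Γ) around v and w are both isomorphic,
as labeled graphs, to the r-ball of the Cayley graph of (G,S) via maps ψ_v, ψ_w, then for any
x, y lying within distance r/2 of both v and w one has ψ_v(x)·ψ_v(y)⁻¹ = ψ_w(x)·ψ_w(y)⁻¹. -/
theorem sofic_welldefinedness
    {G : Type*} [Group G] (S : Set G) (hSfin : S.Finite)
    (hSsym : ∀ s ∈ S, s⁻¹ ∈ S) (hSgen : Subgroup.closure S = ⊤)
    (r : ℕ) {V : Type*} [Fintype V]
    (E : Set (V × G × V)) (hE : ∀ e ∈ E, e.2.1 ∈ S)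
    (Γ : SimpleGraph V)
    (hΓ : ∀ u u' : V, Γ.Adj u u' ↔ u ≠ u' ∧ ∃ s ∈ S, ((u, s, u') ∈ E ∨ (u', s, u) ∈ E))
    (v w : V) (ψv ψw : V → G)
    (hv : Set.BijOn ψv {u | Γ.Reachable u v ∧ Γ.dist u v ≤ r} (cayleyBall S r))
    (hw : Set.BijOn ψw {u | Γ.Reachable u w ∧ Γ.dist u w ≤ r} (cayleyBall S r))
    (hψv1 : ψv v = 1) (hψw1 : ψw w = 1)
    (hEv : ∀ u u' : V, (Γ.Reachable u v ∧ Γ.dist u v ≤ r) →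
      (Γ.Reachable u' v ∧ Γ.dist u' v ≤ r) →
      ∀ s ∈ S, ((u, s, u') ∈ E ↔ ψv u * (ψv u')⁻¹ = s))
    (hEw : ∀ u u' : V, (Γ.Reachable u w ∧ Γ.dist u w ≤ r) →
      (Γ.Reachable u' w ∧ Γ.dist u' w ≤ r) →
      ∀ s ∈ S, ((u, s, u') ∈ E ↔ ψw u * (ψw u')⁻¹ = s))
    (x y : V)
    (hxv : Γ.Reachable x v ∧ 2 * Γ.dist x v ≤ r)
    (hyv : Γ.Reachable y v ∧ 2 * Γ.dist y v ≤ r)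
    (hxw : Γ.Reachable x w ∧ 2 * Γ.dist x w ≤ r)
    (hyw : Γ.Reachable y w ∧ 2 * Γ.dist y w ≤ r) :
    ψv x * (ψv y)⁻¹ = ψw x * (ψw y)⁻¹ := by
  have hadj : ∀ u ∈ {u | (Γ.Reachable u v ∧ Γ.dist u v ≤ r) ∧ (Γ.Reachable u w ∧ Γ.dist u w ≤ r)},
      ∀ u' ∈ {u | (Γ.Reachable u v ∧ Γ.dist u v ≤ r) ∧ (Γ.Reachable u w ∧ Γ.dist u w ≤ r)},
      Γ.Adj u u' → ψv u * (ψv u')⁻¹ = ψw u * (ψw u')⁻¹ := by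
    rintro u ⟨huv, huw⟩ u' ⟨huv', huw'⟩ h
    obtain ⟨-, s, hs, he | he⟩ := (hΓ u u').1 h
    · rw [(hEv u u' huv huv' s hs).1 he, (hEw u u' huw huw' s hs).1 he]
    · have := ((hEv u' u huv' huv s hs).1 he).trans ((hEw u' u huw' huw s hs).1 he).symm
      simpa using congrArg (·⁻¹) this
  obtain ⟨p, hp⟩ := SimpleGraph.exists_walk_support_subset_balls hxv hxw
  obtain ⟨q, hq⟩ := SimpleGraph.exists_walk_support_subset_balls hyv hyw
  refine (p.append q.reverse).mul_inv_eq_of_forall_adj hadj fun u hu => ?_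
  rw [SimpleGraph.Walk.mem_support_append_iff, SimpleGraph.Walk.support_reverse,
    List.mem_reverse] at hu
  exact hu.elim (hp u) (hq u)
end

section
/- Fix z ∈ ℂ with Im z ≠ 0 and n ∈ ℕ with n ≥ 1. Then the function ℝ → ℂ, x ↦ (z − x)^{-n}, lies in the closure, with respect to the supremum norm on bounded continuous functions ℝ → ℂ, of the complex linear span of the set of resolvent functions {x ↦ (w − x)^{-1} : w ∈ ℂ, Im w ≠ 0}. In particular, it is a uniform limit on ℝ of finite complex linear combinations of such resolvent functions. -/
theorem sub_ofReal_ne_zero_of_im_ne_zero {w : ℂ} (hw : w.im ≠ 0) (x : ℝ) : w - (x : ℂ) ≠ 0 :=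
  fun h => hw (by simpa using congrArg Complex.im h)

theorem norm_resolvent_le {w : ℂ} (hw : w.im ≠ 0) (x : ℝ) :
    ‖(w - (x : ℂ))⁻¹‖ ≤ |w.im|⁻¹ := by
  rw [norm_inv]
  gcongr
  simpa using Complex.abs_im_le_norm (w - x)

/-- The square of a resolvent function is a uniform limit of elements of the span. -/
theorem exists_mem_span_resolvents_norm_sq_sub_lt {z : ℂ} (hz : z.im ≠ 0) {ε : ℝ} (hε : 0 < ε) :
    ∃ g ∈ Submodule.span ℂ
        {f : ℝ → ℂ | ∃ w : ℂ, w.im ≠ 0 ∧ f = fun x : ℝ => (w - (x : ℂ))⁻¹},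
      ∀ x : ℝ, ‖(z - (x : ℂ))⁻¹ * (z - (x : ℂ))⁻¹ - g x‖ < ε := by
  have hpos : 0 < |z.im| := abs_pos.mpr hz
  set t : ℝ := ε * |z.im| ^ 3 / 2 with ht
  have htpos : 0 < t := by positivity
  have htz : (t : ℂ) ≠ 0 := by exact_mod_cast htpos.ne'
  have hw : (z + t).im ≠ 0 := by simpa using hz
  refine ⟨_, Submodule.smul_mem _ (t : ℂ)⁻¹ (Submodule.sub_mem _
    (Submodule.subset_span ⟨z, hz, rfl⟩) (Submodule.subset_span ⟨z + t, hw, rfl⟩)), fun x => ?_⟩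
  have h₁ := sub_ofReal_ne_zero_of_im_ne_zero hz x
  have h₂ := sub_ofReal_ne_zero_of_im_ne_zero hw x
  have key : (z - (x : ℂ))⁻¹ * (z - (x : ℂ))⁻¹ -
      (t : ℂ)⁻¹ * ((z - (x : ℂ))⁻¹ - (z + t - (x : ℂ))⁻¹) =
      t * ((z - (x : ℂ))⁻¹ * (z - (x : ℂ))⁻¹ * (z + t - (x : ℂ))⁻¹) := by
    field_simp
    ring
  have hb₁ := norm_resolvent_le hz x
  have hb₂ : ‖(z + t - (x : ℂ))⁻¹‖ ≤ |z.im|⁻¹ := by simpa using norm_resolvent_le hw x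
  simp only [Pi.smul_apply, Pi.sub_apply, smul_eq_mul]
  rw [key, norm_mul, norm_mul, norm_mul, Complex.norm_real, Real.norm_of_nonneg htpos.le]
  calc t * (‖(z - (x : ℂ))⁻¹‖ * ‖(z - (x : ℂ))⁻¹‖ * ‖(z + t - (x : ℂ))⁻¹‖)
      ≤ t * (|z.im|⁻¹ * |z.im|⁻¹ * |z.im|⁻¹) := by gcongr
    _ = ε / 2 := by rw [ht]; field_simp
    _ < ε := half_lt_self hε

/-- The uniform closure of the span of the resolvent functions contains the product of any element
of the span with a resolvent function. -/
theorem exists_mem_span_resolvents_norm_mul_sub_lt {z : ℂ} (hz : z.im ≠ 0) {f : ℝ → ℂ}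
    (hf : f ∈ Submodule.span ℂ
      {f : ℝ → ℂ | ∃ w : ℂ, w.im ≠ 0 ∧ f = fun x : ℝ => (w - (x : ℂ))⁻¹}) :
    ∀ ε : ℝ, 0 < ε →
      ∃ g ∈ Submodule.span ℂ
          {f : ℝ → ℂ | ∃ w : ℂ, w.im ≠ 0 ∧ f = fun x : ℝ => (w - (x : ℂ))⁻¹},
        ∀ x : ℝ, ‖f x * (z - (x : ℂ))⁻¹ - g x‖ < ε := by
  induction hf using Submodule.span_induction with
  | mem f hf =>
    obtain ⟨w, hw, rfl⟩ := hf
    intro ε hε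
    rcases eq_or_ne w z with rfl | hne
    · exact exists_mem_span_resolvents_norm_sq_sub_lt hz hε
    · refine ⟨_, Submodule.smul_mem _ (w - z)⁻¹ (Submodule.sub_mem _
        (Submodule.subset_span ⟨z, hz, rfl⟩) (Submodule.subset_span ⟨w, hw, rfl⟩)), fun x => ?_⟩
      have h₁ := sub_ofReal_ne_zero_of_im_ne_zero hz x
      have h₂ := sub_ofReal_ne_zero_of_im_ne_zero hw x
      have h₃ := sub_ne_zero.mpr hne
      have key : (w - (x : ℂ))⁻¹ * (z - (x : ℂ))⁻¹ -
          (w - z)⁻¹ * ((z - (x : ℂ))⁻¹ - (w - (x : ℂ))⁻¹) = 0 := by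
        field_simp
        ring
      simpa [key] using hε
  | zero => exact fun ε hε => ⟨0, Submodule.zero_mem _, fun x => by simpa using hε⟩
  | add f₁ f₂ _ _ ih₁ ih₂ =>
    intro ε hε
    obtain ⟨g₁, hg₁, h₁⟩ := ih₁ (ε / 2) (half_pos hε)
    obtain ⟨g₂, hg₂, h₂⟩ := ih₂ (ε / 2) (half_pos hε)
    refine ⟨g₁ + g₂, Submodule.add_mem _ hg₁ hg₂, fun x => ?_⟩
    rw [Pi.add_apply, Pi.add_apply, add_mul, add_sub_add_comm]
    exact (norm_add_le _ _).trans_lt (by linarith [h₁ x, h₂ x])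
  | smul c f _ ih =>
    intro ε hε
    obtain ⟨g, hg, h⟩ := ih (ε / (‖c‖ + 1)) (by positivity)
    refine ⟨c • g, Submodule.smul_mem _ c hg, fun x => ?_⟩
    rw [Pi.smul_apply, Pi.smul_apply, smul_eq_mul, smul_eq_mul, mul_assoc, ← mul_sub, norm_mul]
    have hx := (lt_div_iff₀' (by positivity : (0 : ℝ) < ‖c‖ + 1)).mp (h x)
    refine lt_of_le_of_lt ?_ hx
    gcongr
    linarith

/-- For z ∈ ℂ with Im z ≠ 0 and n ≥ 1, the function x ↦ (z − x)^{-n} on ℝ is a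
uniform limit of finite complex linear combinations of resolvent functions
x ↦ (w − x)^{-1}, w ∈ ℂ \ ℝ. -/
theorem resolvent_power_mem_closure_span_resolvents
    (z : ℂ) (hz : z.im ≠ 0) (n : ℕ) (hn : 1 ≤ n) :
    ∀ ε : ℝ, 0 < ε →
      ∃ g ∈ Submodule.span ℂ
          {f : ℝ → ℂ | ∃ w : ℂ, w.im ≠ 0 ∧ f = fun x : ℝ => (w - (x : ℂ))⁻¹},
        ∀ x : ℝ, ‖((z - (x : ℂ)) ^ n)⁻¹ - g x‖ < ε := by
  induction n, hn using Nat.le_induction with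
  | base => exact fun ε hε => ⟨_, Submodule.subset_span ⟨z, hz, rfl⟩, fun x => by simpa using hε⟩
  | succ n _ ih =>
    intro ε hε
    have hpos : 0 < |z.im| := abs_pos.mpr hz
    obtain ⟨g, hg, h⟩ := ih (ε / 2 * |z.im|) (by positivity)
    obtain ⟨g', hg', h'⟩ := exists_mem_span_resolvents_norm_mul_sub_lt hz hg (ε / 2) (half_pos hε)
    refine ⟨g', hg', fun x => ?_⟩
    have hle : ‖(((z - (x : ℂ)) ^ n)⁻¹ - g x) * (z - (x : ℂ))⁻¹‖ ≤ ε / 2 := by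
      rw [norm_mul]
      calc ‖((z - (x : ℂ)) ^ n)⁻¹ - g x‖ * ‖(z - (x : ℂ))⁻¹‖
          ≤ ε / 2 * |z.im| * |z.im|⁻¹ := by
            gcongr
            · exact (h x).le
            · exact norm_resolvent_le hz x
        _ = ε / 2 := by field_simp
    have key : ((z - (x : ℂ)) ^ (n + 1))⁻¹ - g' x =
        (((z - (x : ℂ)) ^ n)⁻¹ - g x) * (z - (x : ℂ))⁻¹ +
          (g x * (z - (x : ℂ))⁻¹ - g' x) := by
      rw [pow_succ, mul_inv]
      ring
    rw [key]
    exact (norm_add_le _ _).trans_lt (by linarith [h' x])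
end

section
/- Let (μ_r)_{r∈ℕ} and μ be Borel probability measures on ℝ. Assume that for every z ∈ ℂ with Im z ≠ 0 one has lim_{r→∞} ∫_ℝ (z − x)^{-1} dμ_r(x) = ∫_ℝ (z − x)^{-1} dμ(x). Then μ_r converges weakly to μ; in particular, for every λ ∈ ℝ with μ({λ}) = 0, one has lim_{r→∞} μ_r((−∞, λ]) = μ((−∞, λ]). -/
open MeasureTheory Filter

open scoped Topology BoundedContinuousFunction

lemma sub_ofReal_ne_zero_of_im_ne_zero_s4 {z : ℂ} (hz : z.im ≠ 0) (x : ℝ) : z - (x : ℂ) ≠ 0 :=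
  fun h => hz (by simpa using congrArg Complex.im h)

lemma norm_inv_sub_ofReal_le {z : ℂ} (hz : z.im ≠ 0) (x : ℝ) :
    ‖(z - (x : ℂ))⁻¹‖ ≤ |z.im|⁻¹ := by
  rw [norm_inv]
  have h := Complex.abs_im_le_norm (z - (x : ℂ))
  rw [Complex.sub_im, Complex.ofReal_im, sub_zero] at h
  exact inv_anti₀ (abs_pos.mpr hz) h

/-- The function `x ↦ (z - x)⁻¹` on the real line, for non-real `z`, as a bounded continuous
function. -/
noncomputable def cauchyKernel (z : ℂ) (hz : z.im ≠ 0) : ℝ →ᵇ ℂ :=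
  BoundedContinuousFunction.ofNormedAddCommGroup (fun x : ℝ => (z - (x : ℂ))⁻¹)
    (Continuous.inv₀ (by fun_prop) (sub_ofReal_ne_zero_of_im_ne_zero_s4 hz))
    |z.im|⁻¹ (norm_inv_sub_ofReal_le hz)

@[simp]
lemma cauchyKernel_apply (z : ℂ) (hz : z.im ≠ 0) (x : ℝ) :
    cauchyKernel z hz x = (z - (x : ℂ))⁻¹ := rfl

lemma norm_cauchyKernel_le (z : ℂ) (hz : z.im ≠ 0) : ‖cauchyKernel z hz‖ ≤ |z.im|⁻¹ :=
  BoundedContinuousFunction.norm_ofNormedAddCommGroup_le _ (by positivity) _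

/-- The resolvent identity. -/
lemma cauchyKernel_sub_cauchyKernel (z w : ℂ) (hz : z.im ≠ 0) (hw : w.im ≠ 0) :
    cauchyKernel z hz - cauchyKernel w hw = (w - z) • (cauchyKernel z hz * cauchyKernel w hw) := by
  ext x
  have h1 := sub_ofReal_ne_zero_of_im_ne_zero_s4 hz x
  have h2 := sub_ofReal_ne_zero_of_im_ne_zero_s4 hw x
  simp only [BoundedContinuousFunction.coe_sub, Pi.sub_apply, cauchyKernel_apply,
    BoundedContinuousFunction.coe_smul, BoundedContinuousFunction.coe_mul, Pi.mul_apply,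
    smul_eq_mul]
  field_simp
  ring

lemma star_cauchyKernel (z : ℂ) (hz : z.im ≠ 0) :
    star (cauchyKernel z hz) = cauchyKernel (star z) (by simpa using hz) := by
  ext x
  simp

/-- The set of all functions `x ↦ (z - x)⁻¹` with `z` non-real. -/
def cauchyKernels : Set (ℝ →ᵇ ℂ) := {f | ∃ (z : ℂ) (hz : z.im ≠ 0), cauchyKernel z hz = f}

lemma star_cauchyKernels : star cauchyKernels = cauchyKernels := by
  refine Set.Subset.antisymm ?_ ?_
  · rintro f ⟨z, hz, hf⟩
    exact ⟨star z, by simpa using hz, by rw [← star_cauchyKernel z hz, hf, star_star]⟩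
  · rintro f ⟨z, hz, rfl⟩
    exact ⟨star z, by simpa using hz, (star_cauchyKernel z hz).symm⟩

/-- The closed linear span of the constants and the functions `x ↦ (z - x)⁻¹`. -/
noncomputable def cauchyKernelSpan : Submodule ℂ (ℝ →ᵇ ℂ) :=
  (Submodule.span ℂ (insert 1 cauchyKernels)).topologicalClosure

lemma one_mem_cauchyKernelSpan : (1 : ℝ →ᵇ ℂ) ∈ cauchyKernelSpan :=
  Submodule.le_topologicalClosure _ (Submodule.subset_span (Set.mem_insert _ _))

lemma cauchyKernel_mem_cauchyKernelSpan (z : ℂ) (hz : z.im ≠ 0) :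
    cauchyKernel z hz ∈ cauchyKernelSpan :=
  Submodule.le_topologicalClosure _ (Submodule.subset_span (Set.mem_insert_of_mem _ ⟨z, hz, rfl⟩))

lemma isClosed_cauchyKernelSpan : IsClosed (cauchyKernelSpan : Set (ℝ →ᵇ ℂ)) :=
  Submodule.isClosed_topologicalClosure _

lemma cauchyKernel_mul_mem_of_ne (z w : ℂ) (hz : z.im ≠ 0) (hw : w.im ≠ 0) (hzw : z ≠ w) :
    cauchyKernel z hz * cauchyKernel w hw ∈ cauchyKernelSpan := by
  have h := cauchyKernel_sub_cauchyKernel z w hz hw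
  have h' : cauchyKernel z hz * cauchyKernel w hw
      = (w - z)⁻¹ • (cauchyKernel z hz - cauchyKernel w hw) := by
    rw [h, inv_smul_smul₀ (sub_ne_zero.mpr hzw.symm)]
  rw [h']
  exact cauchyKernelSpan.smul_mem _ (cauchyKernelSpan.sub_mem
    (cauchyKernel_mem_cauchyKernelSpan z hz) (cauchyKernel_mem_cauchyKernelSpan w hw))

lemma dist_cauchyKernel_real_add_le (z : ℂ) (hz : z.im ≠ 0) (t : ℝ) :
    dist (cauchyKernel (t + z) (by simpa using hz)) (cauchyKernel z hz)
      ≤ |t| * (|z.im|⁻¹ * |z.im|⁻¹) := by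
  rw [dist_eq_norm, cauchyKernel_sub_cauchyKernel, norm_smul]
  gcongr
  · simp
  · refine (norm_mul_le _ _).trans ?_
    gcongr
    · simpa using norm_cauchyKernel_le (t + z) (by simpa using hz)
    · exact norm_cauchyKernel_le z hz

lemma tendsto_cauchyKernel_real_add (z : ℂ) (hz : z.im ≠ 0) :
    Tendsto (fun t : ℝ => cauchyKernel (t + z) (by simpa using hz)) (𝓝[≠] 0)
      (𝓝 (cauchyKernel z hz)) := by
  rw [tendsto_iff_dist_tendsto_zero]
  refine squeeze_zero (fun _ => dist_nonneg) (dist_cauchyKernel_real_add_le z hz) ?_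
  have h : Continuous fun t : ℝ => |t| * (|z.im|⁻¹ * |z.im|⁻¹) := by fun_prop
  simpa using (h.tendsto 0).mono_left nhdsWithin_le_nhds

lemma cauchyKernel_mul_cauchyKernel_mem (z w : ℂ) (hz : z.im ≠ 0) (hw : w.im ≠ 0) :
    cauchyKernel z hz * cauchyKernel w hw ∈ cauchyKernelSpan := by
  by_cases hzw : z = w
  · subst hzw
    refine isClosed_cauchyKernelSpan.mem_of_tendsto
      ((tendsto_cauchyKernel_real_add z hz).mul_const (cauchyKernel z hz)) ?_
    filter_upwards [self_mem_nhdsWithin] with t ht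
    exact cauchyKernel_mul_mem_of_ne _ _ _ _ (by simpa using ht)
  · exact cauchyKernel_mul_mem_of_ne z w hz hw hzw

lemma cauchyKernel_mul_mem (z : ℂ) (hz : z.im ≠ 0) {f : ℝ →ᵇ ℂ} (hf : f ∈ cauchyKernelSpan) :
    cauchyKernel z hz * f ∈ cauchyKernelSpan := by
  have key : cauchyKernelSpan ≤
      cauchyKernelSpan.comap (LinearMap.mulLeft ℂ (cauchyKernel z hz)) := by
    refine Submodule.topologicalClosure_minimal _ (Submodule.span_le.mpr ?_) ?_
    · rintro g (rfl | ⟨w, hw, rfl⟩)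
      · simpa using cauchyKernel_mem_cauchyKernelSpan z hz
      · exact cauchyKernel_mul_cauchyKernel_mem z w hz hw
    · exact isClosed_cauchyKernelSpan.preimage (continuous_const_mul (cauchyKernel z hz))
  exact key hf

lemma adjoin_cauchyKernels_le {f : ℝ →ᵇ ℂ} (hf : f ∈ StarAlgebra.adjoin ℂ cauchyKernels) :
    f ∈ cauchyKernelSpan := by
  have hf' : f ∈ Subalgebra.toSubmodule (Algebra.adjoin ℂ cauchyKernels) := by
    rw [Subalgebra.mem_toSubmodule]
    rw [← StarSubalgebra.mem_toSubalgebra, StarAlgebra.adjoin_toSubalgebra, star_cauchyKernels,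
      Set.union_self] at hf
    exact hf
  rw [Algebra.adjoin_eq_span] at hf'
  refine Submodule.span_le.mpr (fun g hg => ?_) hf'
  induction hg using Submonoid.closure_induction_left with
  | one => exact one_mem_cauchyKernelSpan
  | mul_left g hg k _ ih =>
    obtain ⟨z, hz, rfl⟩ := hg
    exact cauchyKernel_mul_mem z hz ih

lemma separatesPoints_adjoin_cauchyKernels :
    ((StarAlgebra.adjoin ℂ cauchyKernels).map
      (BoundedContinuousFunction.toContinuousMapStarₐ ℂ)).SeparatesPoints := by
  intro x y hxy
  have hI : Complex.I.im ≠ 0 := by simp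
  refine ⟨cauchyKernel Complex.I hI, ⟨_, ⟨cauchyKernel Complex.I hI,
    StarAlgebra.subset_adjoin ℂ _ ⟨_, hI, rfl⟩, rfl⟩, rfl⟩, ?_⟩
  simpa using hxy

section

variable {ι : Type*} {l : Filter ι} {μ : ι → Measure ℝ} {ν : Measure ℝ}

lemma dist_integral_integral_le_dist (ρ : Measure ℝ) [IsProbabilityMeasure ρ]
    (f g : ℝ →ᵇ ℂ) : dist (∫ x, f x ∂ρ) (∫ x, g x ∂ρ) ≤ dist f g := by
  rw [dist_eq_norm, ← integral_sub (f.integrable ρ) (g.integrable ρ), dist_eq_norm]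
  exact (f - g).norm_integral_le_norm ρ

lemma isClosed_setOf_tendsto_integral [∀ i, IsProbabilityMeasure (μ i)]
    [IsProbabilityMeasure ν] :
    IsClosed {f : ℝ →ᵇ ℂ | Tendsto (fun i => ∫ x, f x ∂(μ i)) l (𝓝 (∫ x, f x ∂ν))} := by
  refine isClosed_of_closure_subset fun f hf => ?_
  rw [Set.mem_ofPred_eq, Metric.tendsto_nhds]
  intro ε hε
  obtain ⟨g, hg, hfg⟩ := Metric.mem_closure_iff.mp hf (ε / 3) (by positivity)
  filter_upwards [Metric.tendsto_nhds.mp hg (ε / 3) (by positivity)] with i hi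
  have h1 := dist_integral_integral_le_dist (μ i) f g
  have h2 := dist_integral_integral_le_dist ν g f
  rw [dist_comm g f] at h2
  have h3 := dist_triangle4 (∫ x, f x ∂(μ i)) (∫ x, g x ∂(μ i)) (∫ x, g x ∂ν) (∫ x, f x ∂ν)
  linarith

lemma tendsto_integral_of_mem_cauchyKernelSpan [∀ i, IsProbabilityMeasure (μ i)]
    [IsProbabilityMeasure ν]
    (h : ∀ z : ℂ, z.im ≠ 0 →
      Tendsto (fun i => ∫ x : ℝ, (z - (x : ℂ))⁻¹ ∂(μ i)) l (𝓝 (∫ x : ℝ, (z - (x : ℂ))⁻¹ ∂ν)))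
    {f : ℝ →ᵇ ℂ} (hf : f ∈ cauchyKernelSpan) :
    Tendsto (fun i => ∫ x, f x ∂(μ i)) l (𝓝 (∫ x, f x ∂ν)) := by
  refine closure_minimal (fun g hg => ?_) isClosed_setOf_tendsto_integral hf
  induction hg using Submodule.span_induction with
  | mem g hg =>
    obtain rfl | ⟨z, hz, rfl⟩ := hg
    · simpa using tendsto_const_nhds
    · exact h z hz
  | zero => simpa using tendsto_const_nhds
  | add f g _ _ hf hg =>
    have key (ρ : Measure ℝ) [IsProbabilityMeasure ρ] :
        ∫ x, (f + g) x ∂ρ = ∫ x, f x ∂ρ + ∫ x, g x ∂ρ :=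
      integral_add (f.integrable ρ) (g.integrable ρ)
    simp only [Set.mem_ofPred_eq, key] at hf hg ⊢
    exact hf.add hg
  | smul c f _ hf =>
    have key (ρ : Measure ℝ) : ∫ x, (c • f) x ∂ρ = c * ∫ x, f x ∂ρ :=
      integral_const_mul c _
    simp only [Set.mem_ofPred_eq, key] at hf ⊢
    exact hf.const_mul c

end

lemma one_sub_re_I_mul_inv (y x : ℝ) (hy : 0 < y) :
    1 - (Complex.I * y * (Complex.I * y - (x : ℂ))⁻¹).re = x ^ 2 / (x ^ 2 + y ^ 2) := by
  have h : x ^ 2 + y ^ 2 ≠ 0 := by positivity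
  have h' : x * x + y * y ≠ 0 := by simpa [sq] using h
  simp [Complex.inv_re, Complex.inv_im, Complex.normSq_apply]
  field_simp
  ring

lemma integral_sq_div_sq_add_sq (ρ : Measure ℝ) [IsProbabilityMeasure ρ] (y : ℝ) (hy : 0 < y) :
    ∫ x, x ^ 2 / (x ^ 2 + y ^ 2) ∂ρ
      = 1 - (Complex.I * y * ∫ x : ℝ, (Complex.I * y - (x : ℂ))⁻¹ ∂ρ).re := by
  have him : (Complex.I * y).im ≠ 0 := by simpa using hy.ne'
  have hint : Integrable (fun x : ℝ => Complex.I * y * (Complex.I * y - (x : ℂ))⁻¹) ρ :=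
    ((cauchyKernel _ him).integrable ρ).const_mul _
  rw [← integral_const_mul]
  simp_rw [← one_sub_re_I_mul_inv y _ hy]
  have hre : ∫ x : ℝ, (Complex.I * y * (Complex.I * y - (x : ℂ))⁻¹).re ∂ρ
      = (∫ x : ℝ, Complex.I * y * (Complex.I * y - (x : ℂ))⁻¹ ∂ρ).re := integral_re hint
  have hint' : Integrable (fun x : ℝ => (Complex.I * y * (Complex.I * y - (x : ℂ))⁻¹).re) ρ :=
    hint.re
  rw [integral_sub (integrable_const _) hint', hre]
  simp

lemma sq_div_sq_add_sq_le_one (x y : ℝ) : x ^ 2 / (x ^ 2 + y ^ 2) ≤ 1 :=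
  div_le_one_of_le₀ (by nlinarith [sq_nonneg y]) (by positivity)

lemma integrable_sq_div_sq_add_sq (ρ : Measure ℝ) [IsProbabilityMeasure ρ] (y : ℝ) :
    Integrable (fun x : ℝ => x ^ 2 / (x ^ 2 + y ^ 2)) ρ := by
  refine Integrable.of_bound (Measurable.aestronglyMeasurable (by fun_prop)) 1 (ae_of_all _ ?_)
  intro x
  rw [Real.norm_of_nonneg (by positivity)]
  exact sq_div_sq_add_sq_le_one x y

lemma measure_norm_gt_le (ρ : Measure ℝ) [IsProbabilityMeasure ρ] (y : ℝ) (hy : 0 < y) :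
    ρ {x | y < ‖x‖} ≤ ENNReal.ofReal (2 * ∫ x, x ^ 2 / (x ^ 2 + y ^ 2) ∂ρ) := by
  have h := mul_meas_ge_le_integral_of_nonneg (μ := ρ)
    (f := fun x : ℝ => x ^ 2 / (x ^ 2 + y ^ 2)) (ae_of_all _ fun x => by positivity)
    (integrable_sq_div_sq_add_sq ρ y) (1 / 2)
  have hsub : {x : ℝ | y < ‖x‖} ⊆ {x : ℝ | 1 / 2 ≤ x ^ 2 / (x ^ 2 + y ^ 2)} := by
    intro x hx
    have hx' : y ^ 2 ≤ x ^ 2 := by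
      rw [← sq_abs x]
      exact pow_le_pow_left₀ hy.le (le_of_lt hx) 2
    rw [Set.mem_ofPred_eq, div_le_div_iff₀ (by norm_num) (by positivity)]
    linarith
  refine (measure_mono hsub).trans ?_
  rw [← ofReal_measureReal]
  exact ENNReal.ofReal_le_ofReal (by linarith)

lemma tendsto_integral_sq_div_sq_add_sq (ρ : Measure ℝ) [IsProbabilityMeasure ρ] :
    Tendsto (fun y : ℝ => ∫ x, x ^ 2 / (x ^ 2 + y ^ 2) ∂ρ) atTop (𝓝 0) := by
  rw [← integral_zero ℝ ℝ (μ := ρ)]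
  refine tendsto_integral_filter_of_dominated_convergence (fun _ => 1)
    (Eventually.of_forall fun y => (integrable_sq_div_sq_add_sq ρ y).aestronglyMeasurable)
    (Eventually.of_forall fun y => ae_of_all _ fun x => ?_) (integrable_const _)
    (ae_of_all _ fun x => ?_)
  · rw [Real.norm_of_nonneg (by positivity)]
    exact sq_div_sq_add_sq_le_one x y
  · exact tendsto_const_nhds.div_atTop
      (tendsto_atTop_add_const_left _ _ (tendsto_pow_atTop two_ne_zero))

/-- A sequence of probability measures whose Stieltjes transforms converge to the Stieltjes
transform of a probability measure is tight. -/
lemma isTightMeasureSet_range_of_tendsto_stieltjes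
    {μ : ℕ → Measure ℝ} {ν : Measure ℝ}
    [∀ r, IsProbabilityMeasure (μ r)] [IsProbabilityMeasure ν]
    (h : ∀ z : ℂ, z.im ≠ 0 →
      Tendsto (fun r => ∫ x : ℝ, (z - (x : ℂ))⁻¹ ∂(μ r)) atTop
        (𝓝 (∫ x : ℝ, (z - (x : ℂ))⁻¹ ∂ν))) :
    IsTightMeasureSet (Set.range μ) := by
  refine isTightMeasureSet_range_of_tendsto_limsup_measure_norm_gt ?_
  have hlim : Tendsto (fun y : ℝ => ENNReal.ofReal (2 * ∫ x, x ^ 2 / (x ^ 2 + y ^ 2) ∂ν)) atTop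
      (𝓝 0) := by
    simpa using ENNReal.tendsto_ofReal ((tendsto_integral_sq_div_sq_add_sq ν).const_mul 2)
  refine tendsto_of_tendsto_of_tendsto_of_le_of_le' tendsto_const_nhds hlim
    (Eventually.of_forall fun _ => zero_le) ?_
  filter_upwards [eventually_gt_atTop 0] with y hy
  have hconv : Tendsto (fun r => ENNReal.ofReal (2 * ∫ x, x ^ 2 / (x ^ 2 + y ^ 2) ∂(μ r))) atTop
      (𝓝 (ENNReal.ofReal (2 * ∫ x, x ^ 2 / (x ^ 2 + y ^ 2) ∂ν))) := by
    simp_rw [integral_sq_div_sq_add_sq _ y hy]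
    refine ENNReal.tendsto_ofReal (Tendsto.const_mul 2 (Tendsto.const_sub 1 ?_))
    exact (Complex.continuous_re.tendsto _).comp
      ((h (Complex.I * y) (by simpa using hy.ne')).const_mul _)
  rw [← hconv.limsup_eq]
  exact limsup_le_limsup (Eventually.of_forall fun r => measure_norm_gt_le (μ r) y hy)

/-- If the Stieltjes transforms of probability measures μ_r on ℝ converge to the
Stieltjes transform of a probability measure μ at every non-real z, then μ_r → μ weakly; in
particular the distribution functions converge at every point that is not an atom of μ. -/
theorem weak_convergence_of_stieltjes_convergence
    (μ : ℕ → Measure ℝ) (ν : Measure ℝ)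
    [∀ r, IsProbabilityMeasure (μ r)] [IsProbabilityMeasure ν]
    (h : ∀ z : ℂ, z.im ≠ 0 →
      Tendsto (fun r => ∫ x : ℝ, (z - (x : ℂ))⁻¹ ∂(μ r)) atTop
        (nhds (∫ x : ℝ, (z - (x : ℂ))⁻¹ ∂ν))) :
    (∀ f : BoundedContinuousFunction ℝ ℝ,
      Tendsto (fun r => ∫ x, f x ∂(μ r)) atTop (nhds (∫ x, f x ∂ν))) ∧
    (∀ lam : ℝ, ν {lam} = 0 →
      Tendsto (fun r => ((μ r) (Set.Iic lam)).toReal) atTop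
        (nhds ((ν (Set.Iic lam)).toReal))) := by
  let P : ℕ → ProbabilityMeasure ℝ := fun r => ⟨μ r, inferInstance⟩
  let Q : ProbabilityMeasure ℝ := ⟨ν, inferInstance⟩
  have hPQ : Tendsto P atTop (𝓝 Q) :=
    ProbabilityMeasure.tendsto_of_tight_of_separatesPoints ℂ (μ := P) (μ₀ := Q)
      (isTightMeasureSet_range_of_tendsto_stieltjes (μ := μ) h) separatesPoints_adjoin_cauchyKernels
      fun _ hg => tendsto_integral_of_mem_cauchyKernelSpan h (adjoin_cauchyKernels_le hg)
  refine ⟨ProbabilityMeasure.tendsto_iff_forall_integral_tendsto.mp hPQ, fun lam hlam => ?_⟩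
  refine (ENNReal.tendsto_toReal (measure_ne_top ν _)).comp
    (ProbabilityMeasure.tendsto_measure_of_null_frontier_of_tendsto' hPQ ?_)
  rw [frontier_Iic]
  exact hlam
end

section
/- Let G be a countably infinite group and (Ω,𝒜,ℙ) a probability space. Let {a(x,y) : Ω → ℂ | x,y ∈ G} be measurable random variables with a(x,y) = conj(a(y,x)) for all x,y, such that for every z ∈ G the families (a(x,y))_{x,y∈G} and (a(xz,yz))_{x,y∈G} are identically distributed, and such that E[(∑_{x∈G} |a(x,1)|)²] < ∞. Then there is a measurable set Ω̃ ⊆ Ω with ℙ(Ω̃) = 1 such that for every ω ∈ Ω̃: (i) the operator Ã^{(ω)} with domain D₀ given by (Ã^{(ω)} f)(x) = ∑_{y∈G} a^{(ω)}(x,y) f(y) is a well-defined symmetric operator into ℓ²(G); and (ii) Ã^{(ω)} is essentially self-adjoint; equivalently, for every z ∈ ℂ with Im z ≠ 0 the set {z·f − Ã^{(ω)} f : f ∈ D₀} is dense in ℓ²(G). -/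
open MeasureTheory
open scoped ENNReal NNReal BigOperators

namespace RandomMatrix

open scoped Classical
open Polynomial

section SquareSummable

variable {ι : Type*}

lemma tsum_enorm_sq_eq (v : lp (fun _ : ι => ℂ) 2) : ∑' x, ‖v x‖ₑ ^ 2 = ‖v‖ₑ ^ 2 := by
  have h := lp.hasSum_norm (p := 2) (by norm_num) v
  norm_num at h
  have h2 := ENNReal.ofReal_tsum_of_nonneg (fun x => sq_nonneg ‖v x‖) h.summable
  rw [h.tsum_eq] at h2
  simpa [ENNReal.ofReal_pow] using h2.symm

lemma memℓp_two_iff {f : ι → ℂ} : Memℓp f 2 ↔ ∑' x, ‖f x‖ₑ ^ 2 ≠ ⊤ := by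
  constructor
  · intro h
    have := tsum_enorm_sq_eq (⟨f, h⟩ : lp (fun _ : ι => ℂ) 2)
    simp only at this
    rw [this]
    simp
  · intro h
    refine memℓp_gen ?_
    have := ENNReal.summable_toReal h
    simpa using this

lemma tsum_enorm_add_sq_le (f g : ι → ℂ) :
    ∑' x, ‖f x + g x‖ₑ ^ 2 ≤ 2 * (∑' x, ‖f x‖ₑ ^ 2 + ∑' x, ‖g x‖ₑ ^ 2) := by
  rw [← ENNReal.tsum_add, ← ENNReal.tsum_mul_left]
  refine ENNReal.tsum_le_tsum fun x => ?_
  have h : ‖f x + g x‖₊ ^ 2 ≤ 2 * (‖f x‖₊ ^ 2 + ‖g x‖₊ ^ 2) :=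
    (pow_le_pow_left₀ zero_le (nnnorm_add_le _ _) 2).trans add_sq_le
  simp only [enorm]
  exact_mod_cast h

lemma tsum_sq_le_sq_tsum (f : ι → ℝ≥0∞) : ∑' x, f x ^ 2 ≤ (∑' x, f x) ^ 2 := by
  rw [sq (∑' x, f x), ← ENNReal.tsum_mul_left]
  refine ENNReal.tsum_le_tsum fun x => ?_
  rw [sq]
  exact mul_le_mul' (ENNReal.le_tsum x) le_rfl

lemma enorm_sum_mul_sq_le (s : Finset ι) (f g : ι → ℂ) :
    ‖∑ i ∈ s, f i * g i‖ₑ ^ 2 ≤ (∑ i ∈ s, ‖f i‖ₑ) * ∑ i ∈ s, ‖f i‖ₑ * ‖g i‖ₑ ^ 2 := by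
  have h : ‖∑ i ∈ s, f i * g i‖₊ ^ 2 ≤ (∑ i ∈ s, ‖f i‖₊) * ∑ i ∈ s, ‖f i‖₊ * ‖g i‖₊ ^ 2 := by
    calc _ ≤ (∑ i ∈ s, ‖f i * g i‖₊) ^ 2 := by gcongr; exact nnnorm_sum_le _ _
      _ ≤ _ := Finset.sum_sq_le_sum_mul_sum_of_sq_le_mul s (by simp) (by simp)
          (fun i _ => by rw [nnnorm_mul]; exact le_of_eq (by ring))
  simp only [enorm]
  exact_mod_cast h

end SquareSummable

section Resolvent

/-- A polynomial approximation of the resolvent of a bounded self-adjoint operator which depends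
only on the norm bound of the operator. -/
lemma exists_polynomial_resolvent {A : Type*} [CStarAlgebra A] (z : ℂ) (hz : z.im ≠ 0)
    (n : ℝ) (ε : ℝ) (hε : 0 < ε) :
    ∃ p : ℂ[X], ∀ T : A, IsSelfAdjoint T → ‖T‖ ≤ n →
      ‖aeval T p‖ ≤ 2 / |z.im| ∧ ‖(algebraMap ℂ A z - T) * aeval T p - 1‖ ≤ ε := by
  have him : 0 < |z.im| := abs_pos.2 hz
  have hne : ∀ t : ℝ, z - t ≠ 0 := fun t h => hz (by simpa using congrArg Complex.im h)
  obtain ⟨δ, hδ, h1, h2⟩ : ∃ δ > 0, (‖z‖ + |n|) * δ ≤ 1 / |z.im| ∧ (‖z‖ + |n|) ^ 2 * δ ≤ ε := by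
    set K := ‖z‖ + |n|
    have hK : 0 ≤ K := by positivity
    refine ⟨min ((1 / |z.im|) / (K + 1)) (ε / (K ^ 2 + 1)), by positivity, ?_, ?_⟩
    · calc _ ≤ K * ((1 / |z.im|) / (K + 1)) := by gcongr; exact min_le_left _ _
        _ = (1 / |z.im|) * (K / (K + 1)) := by ring
        _ ≤ (1 / |z.im|) * 1 := by gcongr; rw [div_le_one (by positivity)]; linarith
        _ = _ := mul_one _
    · calc _ ≤ K ^ 2 * (ε / (K ^ 2 + 1)) := by gcongr; exact min_le_right _ _
        _ = ε * (K ^ 2 / (K ^ 2 + 1)) := by ring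
        _ ≤ ε * 1 := by gcongr; rw [div_le_one (by positivity)]; linarith
        _ = _ := mul_one _
  obtain ⟨q, hq⟩ := exists_polynomial_near_of_continuousOn (-n) n
    (fun t : ℝ => 1 / ‖z - t‖ ^ 2)
    (by
      refine Continuous.continuousOn (continuous_const.div (by fun_prop) fun t => ?_)
      exact pow_ne_zero _ (norm_ne_zero_iff.2 (hne t))) δ hδ
  refine ⟨(C (starRingEnd ℂ z) - X) * q.map Complex.ofRealHom, fun T hT hTn => ?_⟩
  have hspec : ∀ x ∈ spectrum ℂ T, ∃ t : ℝ, x = t ∧ t ∈ Set.Icc (-n) n := by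
    intro x hx
    refine ⟨x.re, hT.mem_spectrum_eq_re hx, ?_⟩
    obtain _ | _ := subsingleton_or_nontrivial A
    · simp [spectrum.of_subsingleton] at hx
    · refine abs_le.1 ((Complex.abs_re_le_norm x).trans ?_)
      simpa using (spectrum.norm_le_norm_mul_of_mem hx).trans (by simpa using hTn)
  have heval : ∀ t : ℝ, t ∈ Set.Icc (-n) n →
      ∃ r : ℝ, ((C (starRingEnd ℂ z) - X) * q.map Complex.ofRealHom).eval (t : ℂ)
        = starRingEnd ℂ (z - t) * ((1 / ‖z - t‖ ^ 2 + r : ℝ) : ℂ) ∧ |r| ≤ δ ∧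
        ‖z - t‖ ≤ ‖z‖ + |n| := by
    intro t ht
    refine ⟨q.eval t - 1 / ‖z - t‖ ^ 2, ?_, (hq t ht).le, ?_⟩
    · rw [eval_mul, eval_sub, eval_C, eval_X, map_sub, Complex.conj_ofReal]
      congr 1
      rw [add_sub_cancel, show (t : ℂ) = Complex.ofRealHom t from rfl, eval_map_apply]
      rfl
    · refine (norm_sub_le _ _).trans ?_
      gcongr
      rw [Complex.norm_real, Real.norm_eq_abs]
      exact (abs_le.2 ht).trans (le_abs_self n)
  constructor
  · rw [← cfc_polynomial _ T hT.isStarNormal]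
    refine norm_cfc_le (by positivity) fun x hx => ?_
    obtain ⟨t, rfl, ht⟩ := hspec x hx
    obtain ⟨r, hr, hrδ, hzt⟩ := heval t ht
    have hpos : 0 < ‖z - t‖ := norm_pos_iff.2 (hne t)
    have hle : |z.im| ≤ ‖z - t‖ := by simpa using Complex.abs_im_le_norm (z - t)
    rw [hr, norm_mul, RCLike.norm_conj, Complex.norm_real, Real.norm_eq_abs]
    calc _ ≤ ‖z - t‖ * (1 / ‖z - t‖ ^ 2 + |r|) := by
          gcongr
          exact (abs_add_le _ _).trans (by rw [abs_of_pos (by positivity)])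
      _ = 1 / ‖z - t‖ + ‖z - t‖ * |r| := by field_simp
      _ ≤ 1 / |z.im| + (‖z‖ + |n|) * δ := by gcongr
      _ ≤ 1 / |z.im| + 1 / |z.im| := by gcongr
      _ = _ := by ring
  · have : (algebraMap ℂ A z - T) * aeval T ((C (starRingEnd ℂ z) - X) * q.map Complex.ofRealHom)
        - 1 = aeval T ((C z - X) * ((C (starRingEnd ℂ z) - X) * q.map Complex.ofRealHom) - 1) := by
      simp
    rw [this, ← cfc_polynomial _ T hT.isStarNormal]
    refine norm_cfc_le hε.le fun x hx => ?_
    obtain ⟨t, rfl, ht⟩ := hspec x hx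
    obtain ⟨r, hr, hrδ, hzt⟩ := heval t ht
    have hpos : 0 < ‖z - t‖ := norm_pos_iff.2 (hne t)
    have : ((C z - X) * ((C (starRingEnd ℂ z) - X) * q.map Complex.ofRealHom) - 1).eval (t : ℂ)
        = ((‖z - t‖ ^ 2 * r : ℝ) : ℂ) := by
      rw [eval_sub, eval_mul, hr, eval_sub, eval_C, eval_X, eval_one, ← mul_assoc,
        Complex.mul_conj, Complex.normSq_eq_norm_sq, ← Complex.ofReal_mul]
      rw [mul_add, mul_one_div_cancel (by positivity)]
      push_cast
      ring
    rw [this, Complex.norm_real, Real.norm_eq_abs, abs_mul, abs_of_nonneg (by positivity)]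
    calc _ ≤ (‖z‖ + |n|) ^ 2 * δ := by gcongr
      _ ≤ ε := h2

end Resolvent

section BandMatrix

/-- The `ℓ¹` norm of the column of index `x` of a matrix. -/
noncomputable def colSum {ι : Type*} (m : ι → ι → ℂ) (x : ι) : ℝ≥0∞ := ∑' u, ‖m u x‖ₑ

variable {G : Type*} [Group G]

/-- The action on functions of the band matrix with entries `m x y`, `y * x⁻¹ ∈ F`. -/
noncomputable def bandApply (F : Finset G) (m : G → G → ℂ) (f : G → ℂ) (x : G) : ℂ :=
  ∑ v ∈ F, m x (v * x) * f (v * x)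

/-- The matrix of the `k`-th power of `bandApply F m`. -/
noncomputable def bandPow (F : Finset G) (m : G → G → ℂ) : ℕ → G → G → ℂ
  | 0, x, y => if x = y then 1 else 0
  | k + 1, x, y => ∑ v ∈ F, m x (v * x) * bandPow F m k (v * x) y

/-- The matrix of the polynomial `p` in `bandApply F m`. -/
noncomputable def bandPoly (F : Finset G) (p : ℂ[X]) (m : G → G → ℂ) (x y : G) : ℂ :=
  ∑ k ∈ p.support, p.coeff k * bandPow F m k x y

/-- The matrix translated by `z` on the right. -/
def shift (z : G) (m : G → G → ℂ) (x y : G) : ℂ := m (x * z) (y * z)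

lemma colSum_shift (z : G) (m : G → G → ℂ) (x : G) : colSum (shift z m) x = colSum m (x * z) :=
  (Equiv.mulRight z).tsum_eq fun u => ‖m u (x * z)‖ₑ

lemma bandPow_shift (F : Finset G) (z : G) (m : G → G → ℂ) (k : ℕ) (x y : G) :
    bandPow F (shift z m) k x y = bandPow F m k (x * z) (y * z) := by
  induction k generalizing x with
  | zero => simp [bandPow]
  | succ k ih => simp [bandPow, ih, shift, mul_assoc]

lemma bandPoly_shift (F : Finset G) (p : ℂ[X]) (z : G) (m : G → G → ℂ) (x y : G) :
    bandPoly F p (shift z m) x y = bandPoly F p m (x * z) (y * z) := by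
  simp [bandPoly, bandPow_shift]

lemma exists_bandPow_support (F : Finset G) (k : ℕ) :
    ∃ K : Finset G, ∀ (m : G → G → ℂ) (x y : G), bandPow F m k x y ≠ 0 → x * y⁻¹ ∈ K := by
  induction k with
  | zero =>
    refine ⟨{1}, fun m x y h => ?_⟩
    simp only [bandPow, ne_eq, ite_eq_right_iff, one_ne_zero, imp_false, not_not] at h
    simp [h]
  | succ k ih =>
    obtain ⟨K, hK⟩ := ih
    refine ⟨Finset.image₂ (fun v u => v⁻¹ * u) F K, fun m x y h => ?_⟩
    obtain ⟨v, hv, hne⟩ := Finset.exists_ne_zero_of_sum_ne_zero h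
    have := hK m _ _ (right_ne_zero_of_mul hne)
    exact Finset.mem_image₂.2 ⟨v, hv, _, this, by group⟩

lemma exists_bandPoly_support (F : Finset G) (p : ℂ[X]) :
    ∃ K : Finset G, ∀ (m : G → G → ℂ) (x y : G), bandPoly F p m x y ≠ 0 → x * y⁻¹ ∈ K := by
  choose K hK using exists_bandPow_support F
  refine ⟨p.support.biUnion K, fun m x y h => ?_⟩
  obtain ⟨k, hk, hne⟩ := Finset.exists_ne_zero_of_sum_ne_zero h
  exact Finset.mem_biUnion.2 ⟨k, hk, hK k m x y (right_ne_zero_of_mul hne)⟩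

lemma tsum_enorm_bandApply_sq_le {F : Finset G} {m : G → G → ℂ}
    (hsym : ∀ x y, m x y = starRingEnd ℂ (m y x))
    {c : ℝ≥0∞} (hc : ∀ x, colSum m x ≤ c) (f : G → ℂ) :
    ∑' x, ‖bandApply F m f x‖ₑ ^ 2 ≤ c ^ 2 * ∑' x, ‖f x‖ₑ ^ 2 := by
  have hnorm : ∀ x y, ‖m x y‖ₑ = ‖m y x‖ₑ := fun x y => by
    rw [hsym, ← ofReal_norm, ← ofReal_norm, RCLike.norm_conj]
  have hsum : ∀ (x : G) (φ : G → ℝ≥0∞), ∑ v ∈ F, φ (v * x) ≤ ∑' y, φ y := fun x φ =>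
    (ENNReal.sum_le_tsum F).trans_eq ((Equiv.mulRight x).tsum_eq φ)
  calc ∑' x, ‖bandApply F m f x‖ₑ ^ 2
      ≤ ∑' x, c * ∑' y, ‖m x y‖ₑ * ‖f y‖ₑ ^ 2 := by
        refine ENNReal.tsum_le_tsum fun x => (enorm_sum_mul_sq_le F _ _).trans ?_
        gcongr
        · refine (hsum x fun y => ‖m x y‖ₑ).trans ?_
          simp_rw [hnorm x]
          exact hc x
        · exact hsum x fun y => ‖m x y‖ₑ * ‖f y‖ₑ ^ 2
    _ = c * ∑' y, colSum m y * ‖f y‖ₑ ^ 2 := by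
        rw [ENNReal.tsum_mul_left, ENNReal.tsum_comm]
        simp_rw [ENNReal.tsum_mul_right, colSum]
    _ ≤ c * ∑' y, c * ‖f y‖ₑ ^ 2 := by
        gcongr with y
        exact hc y
    _ = _ := by rw [ENNReal.tsum_mul_left, sq, mul_assoc]

/-- Schur's test: a hermitian band matrix whose columns are bounded in `ℓ¹` acts as a bounded
self-adjoint operator on `ℓ²`. -/
lemma exists_bandOperator {F : Finset G} {m : G → G → ℂ}
    (hsym : ∀ x y, m x y = starRingEnd ℂ (m y x)) (hF : ∀ x y, m x y ≠ 0 → y * x⁻¹ ∈ F)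
    {c : ℝ≥0} (hc : ∀ x, colSum m x ≤ c) :
    ∃ T : lp (fun _ : G => ℂ) 2 →L[ℂ] lp (fun _ : G => ℂ) 2, IsSelfAdjoint T ∧ ‖T‖ ≤ c ∧
      ∀ f x, T f x = bandApply F m f x := by
  have hle := tsum_enorm_bandApply_sq_le (F := F) hsym hc
  have hmem : ∀ f : lp (fun _ : G => ℂ) 2, Memℓp (bandApply F m f) 2 := fun f => by
    rw [memℓp_two_iff]
    refine ne_top_of_le_ne_top ?_ (hle f)
    rw [tsum_enorm_sq_eq]
    exact ENNReal.mul_ne_top (by simp) (by simp)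
  let L : lp (fun _ : G => ℂ) 2 →ₗ[ℂ] lp (fun _ : G => ℂ) 2 :=
    { toFun := fun f => ⟨bandApply F m f, hmem f⟩
      map_add' := fun f g => by
        ext x
        change bandApply F m _ x = bandApply F m f x + bandApply F m g x
        simp [bandApply, mul_add, Finset.sum_add_distrib]
      map_smul' := fun r f => by
        ext x
        simp [bandApply, Finset.mul_sum, mul_left_comm] }
  have hL : ∀ f x, L f x = bandApply F m f x := fun f x => rfl
  let T := L.mkContinuous c fun f => by
    have h := hle f
    simp_rw [← hL, tsum_enorm_sq_eq] at h
    rw [← mul_pow] at h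
    simp only [enorm] at h
    norm_cast at h
    have h' : ‖L f‖₊ ≤ c * ‖f‖₊ := (pow_le_pow_iff_left₀ zero_le zero_le two_ne_zero).1 h
    exact_mod_cast h'
  have hT : ∀ f x, T f x = bandApply F m f x := fun f x => rfl
  have hTs : ∀ y x, T (lp.single 2 y (1 : ℂ)) x = m x y := fun y x => by
    rw [hT]
    by_cases h : m x y = 0
    · rw [h]
      refine Finset.sum_eq_zero fun v _ => ?_
      by_cases hv : v * x = y
      · rw [hv, h, zero_mul]
      · simp [lp.single_apply, hv]
    · rw [bandApply, Finset.sum_eq_single (y * x⁻¹)]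
      · simp [lp.single_apply]
      · intro v _ hv
        have : v * x ≠ y := fun h => hv (by simp [← h])
        simp [lp.single_apply, this]
      · exact fun h' => absurd (hF x y h) h'
  refine ⟨T, ?_, L.mkContinuous_norm_le c.2 _, hT⟩
  rw [ContinuousLinearMap.isSelfAdjoint_iff']
  refine lp.ext_continuousLinearMap (by norm_num) fun y => ?_
  ext x
  have h1 := lp.inner_single_left (𝕜 := ℂ) x (1 : ℂ)
    (ContinuousLinearMap.adjoint T (lp.single 2 y (1 : ℂ)))
  rw [ContinuousLinearMap.adjoint_inner_right, lp.inner_single_right, hTs] at h1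
  simp only [RCLike.inner_apply, map_one, mul_one, one_mul] at h1
  simpa [hTs, hsym x y] using h1.symm

lemma aeval_single_apply {F : Finset G} {m : G → G → ℂ}
    {T : lp (fun _ : G => ℂ) 2 →L[ℂ] lp (fun _ : G => ℂ) 2}
    (hT : ∀ f x, T f x = bandApply F m f x) (p : ℂ[X]) (x y : G) :
    aeval T p (lp.single 2 y (1 : ℂ)) x = bandPoly F p m x y := by
  have hpow : ∀ k x, (T ^ k) (lp.single 2 y (1 : ℂ)) x = bandPow F m k x y := by
    intro k
    induction k with
    | zero => intro x; simp [bandPow, lp.single_apply, Pi.single_apply]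
    | succ k ih =>
      intro x
      rw [pow_succ', mul_apply_eq_comp, hT]
      simp only [bandApply, bandPow, ih]
  rw [aeval_eq_sum_range, bandPoly, ← Finset.sum_subset (s₁ := p.support)
    (s₂ := Finset.range (p.natDegree + 1))]
  · simp only [_root_.sum_apply, _root_.smul_apply, lp.coeFn_sum,
      Finset.sum_apply, lp.coeFn_smul, Pi.smul_apply, hpow, smul_eq_mul]
  · exact supp_subset_range_natDegree_succ
  · intro k _ hk
    simp [notMem_support_iff.1 hk]

/-- The transpose of the matrix of a polynomial in a hermitian band matrix is bounded by the norm
of that polynomial. -/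
lemma tsum_enorm_mul_bandPoly_sq_le {F : Finset G} {m : G → G → ℂ} {p : ℂ[X]} {K : Finset G}
    (hK : ∀ x y, bandPoly F p m x y ≠ 0 → x * y⁻¹ ∈ K)
    {T : lp (fun _ : G => ℂ) 2 →L[ℂ] lp (fun _ : G => ℂ) 2}
    (hT : ∀ f x, T f x = bandApply F m f x) {h : G → ℂ} (hh : Memℓp h 2) :
    ∑' x, ‖∑ v ∈ K, starRingEnd ℂ (h (v * x)) * bandPoly F p m (v * x) x‖ₑ ^ 2
      ≤ ‖aeval T p‖ₑ ^ 2 * ∑' x, ‖h x‖ₑ ^ 2 := by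
  set S := aeval T p
  let v₀ : lp (fun _ : G => ℂ) 2 := ⟨h, hh⟩
  have hv₀ : ∀ x, v₀ x = h x := fun x => rfl
  have key : ∀ x, ‖∑ v ∈ K, starRingEnd ℂ (h (v * x)) * bandPoly F p m (v * x) x‖ₑ
      = ‖ContinuousLinearMap.adjoint S v₀ x‖ₑ := by
    intro x
    have h1 := lp.inner_single_right (𝕜 := ℂ) x (1 : ℂ) (ContinuousLinearMap.adjoint S v₀)
    rw [ContinuousLinearMap.adjoint_inner_left, lp.inner_eq_tsum] at h1
    simp only [RCLike.inner_apply, one_mul, S, aeval_single_apply hT, hv₀] at h1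
    rw [← (Equiv.mulRight x).tsum_eq, tsum_eq_sum (s := K)] at h1
    · have h2 : ‖ContinuousLinearMap.adjoint S v₀ x‖ₑ
          = ‖starRingEnd ℂ (ContinuousLinearMap.adjoint S v₀ x)‖ₑ := by
        rw [← ofReal_norm, ← ofReal_norm, RCLike.norm_conj]
      rw [h2, ← h1]
      simp [mul_comm]
    · intro v hv
      by_contra hne
      have := hK (v * x) x (left_ne_zero_of_mul hne)
      simp at this
      exact hv this
  simp_rw [key, tsum_enorm_sq_eq]
  have : ∑' x, ‖h x‖ₑ ^ 2 = ‖v₀‖ₑ ^ 2 := tsum_enorm_sq_eq v₀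
  rw [this, ← mul_pow]
  gcongr
  have h3 := (ContinuousLinearMap.adjoint S).le_opNorm v₀
  rw [LinearIsometryEquiv.norm_map] at h3
  rw [← ofReal_norm, ← ofReal_norm, ← ofReal_norm, ← ENNReal.ofReal_mul (norm_nonneg _)]
  exact ENNReal.ofReal_le_ofReal h3

end BandMatrix

section Truncation

variable {G : Type*} [Group G]

/-- The matrix obtained by keeping only the entries `m x y` with `x * y⁻¹ ∈ F` for which the
columns of index `x` and `y` have `ℓ¹` norm at most `n`. -/
noncomputable def trunc (n : ℕ) (F : Finset G) (m : G → G → ℂ) (x y : G) : ℂ :=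
  if x * y⁻¹ ∈ F ∧ colSum m x ≤ n ∧ colSum m y ≤ n then m x y else 0

/-- The matrix product of `m - trunc n F m` and of the polynomial `p` in `trunc n F m`, the latter
being supported on the entries `(x, y)` with `x * y⁻¹ ∈ K`. -/
noncomputable def truncError (n : ℕ) (F K : Finset G) (p : ℂ[X]) (m : G → G → ℂ) (x y : G) : ℂ :=
  ∑ v ∈ K, (m x (v * y) - trunc n F m x (v * y)) * bandPoly F p (trunc n F m) (v * y) y

lemma trunc_shift (n : ℕ) (F : Finset G) (z : G) (m : G → G → ℂ) :
    trunc n F (shift z m) = shift z (trunc n F m) := by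
  ext x y
  simp [trunc, colSum_shift, shift]

lemma truncError_shift (n : ℕ) (F K : Finset G) (p : ℂ[X]) (z : G) (m : G → G → ℂ) (x y : G) :
    truncError n F K p (shift z m) x y = truncError n F K p m (x * z) (y * z) := by
  simp [truncError, trunc_shift, bandPoly_shift, shift, mul_assoc]

lemma trunc_conj {n : ℕ} {F : Finset G} (hF : ∀ g ∈ F, g⁻¹ ∈ F) {m : G → G → ℂ}
    (hm : ∀ x y, m x y = starRingEnd ℂ (m y x)) (x y : G) :
    trunc n F m x y = starRingEnd ℂ (trunc n F m y x) := by
  have hiff : x * y⁻¹ ∈ F ↔ y * x⁻¹ ∈ F :=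
    ⟨fun h => by simpa using hF _ h, fun h => by simpa using hF _ h⟩
  simp only [trunc, apply_ite (starRingEnd ℂ), map_zero, ← hm, hiff, and_comm (a := colSum m x ≤ n)]

lemma trunc_ne_zero {n : ℕ} {F : Finset G} (hF : ∀ g ∈ F, g⁻¹ ∈ F) {m : G → G → ℂ} {x y : G}
    (h : trunc n F m x y ≠ 0) : y * x⁻¹ ∈ F := by
  have := (ite_ne_right_iff.1 h).1.1
  simpa using hF _ this

lemma colSum_trunc_le (n : ℕ) (F : Finset G) (m : G → G → ℂ) (x : G) :
    colSum (trunc n F m) x ≤ n := by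
  by_cases hx : colSum m x ≤ n
  · refine (ENNReal.tsum_le_tsum fun u => ?_).trans hx
    rw [trunc]
    split_ifs <;> simp
  · have : ∀ u, trunc n F m u x = 0 := fun u => if_neg fun h => hx h.2.2
    simp [colSum, this]

lemma enorm_sub_trunc_le (n : ℕ) (F : Finset G) (m : G → G → ℂ) (x y : G) :
    ‖m x y - trunc n F m x y‖ₑ ≤ ‖m x y‖ₑ := by
  rw [trunc]
  split_ifs <;> simp

lemma tsum_enorm_sub_trunc_sq_le (n : ℕ) (F : Finset G) (m : G → G → ℂ) (w : G) :
    ∑' u, ‖m u w - trunc n F m u w‖ₑ ^ 2 ≤ colSum m w ^ 2 :=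
  (ENNReal.tsum_le_tsum fun u => by gcongr; exact enorm_sub_trunc_le n F m u w).trans
    (tsum_sq_le_sq_tsum _)

lemma exists_truncOperator {n : ℕ} {F : Finset G} (hF : ∀ g ∈ F, g⁻¹ ∈ F) {m : G → G → ℂ}
    (hm : ∀ x y, m x y = starRingEnd ℂ (m y x)) :
    ∃ T : lp (fun _ : G => ℂ) 2 →L[ℂ] lp (fun _ : G => ℂ) 2, IsSelfAdjoint T ∧ ‖T‖ ≤ n ∧
      ∀ f x, T f x = bandApply F (trunc n F m) f x :=
  exists_bandOperator (c := n) (trunc_conj hF hm) (fun _ _ => trunc_ne_zero hF)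
    fun x => by simpa using colSum_trunc_le n F m x

/-- A row of `truncError` is controlled by the corresponding column of `m - trunc n F m`. -/
lemma tsum_enorm_truncError_row_sq_le {n : ℕ} {F K : Finset G} (hF : ∀ g ∈ F, g⁻¹ ∈ F) {p : ℂ[X]}
    (hK : ∀ (m : G → G → ℂ) (x y : G), bandPoly F p m x y ≠ 0 → x * y⁻¹ ∈ K)
    {c : ℝ} (hc : 0 < c)
    (hp : ∀ T : lp (fun _ : G => ℂ) 2 →L[ℂ] lp (fun _ : G => ℂ) 2, IsSelfAdjoint T → ‖T‖ ≤ n →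
      ‖aeval T p‖ ≤ c) {m : G → G → ℂ} (hm : ∀ x y, m x y = starRingEnd ℂ (m y x)) (w : G) :
    ∑' x, ‖truncError n F K p m w x‖ₑ ^ 2
      ≤ ENNReal.ofReal c ^ 2 * ∑' u, ‖m u w - trunc n F m u w‖ₑ ^ 2 := by
  by_cases hmem : Memℓp (fun u => m u w - trunc n F m u w) 2
  · obtain ⟨T, hT, hTn, hTapp⟩ := exists_truncOperator (n := n) hF hm
    have := tsum_enorm_mul_bandPoly_sq_le (hK _) hTapp hmem
    simp only [map_sub, ← hm, ← trunc_conj hF hm] at this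
    refine this.trans ?_
    gcongr
    rw [← ofReal_norm]
    exact ENNReal.ofReal_le_ofReal (hp T hT hTn)
  · rw [memℓp_two_iff, not_not] at hmem
    rw [hmem, ENNReal.mul_top (by positivity)]
    exact le_top

lemma exists_finsupp_approx {n : ℕ} {F K : Finset G} (hF : ∀ g ∈ F, g⁻¹ ∈ F) {p : ℂ[X]}
    (hK : ∀ (m : G → G → ℂ) (x y : G), bandPoly F p m x y ≠ 0 → x * y⁻¹ ∈ K)
    {z : ℂ} {ε : ℝ}
    (hp : ∀ T : lp (fun _ : G => ℂ) 2 →L[ℂ] lp (fun _ : G => ℂ) 2, IsSelfAdjoint T → ‖T‖ ≤ n →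
      ‖(algebraMap ℂ _ z - T) * aeval T p - 1‖ ≤ ε)
    {m : G → G → ℂ} (hm : ∀ x y, m x y = starRingEnd ℂ (m y x)) (w : G) :
    ∃ f : G →₀ ℂ, ∑' g, ‖(Pi.single w 1 : G → ℂ) g - (z * f g - ∑ y ∈ f.support, m g y * f y)‖ₑ ^ 2
      ≤ 2 * (ENNReal.ofReal ε ^ 2 + ∑' x, ‖truncError n F K p m x w‖ₑ ^ 2) := by
  obtain ⟨T, hT, hTn, hTapp⟩ := exists_truncOperator (n := n) hF hm
  set t := trunc n F m with ht
  let φ : G → ℂ := fun x => bandPoly F p t x w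
  have hsupp : ∀ x, φ x ≠ 0 → x ∈ K.image (· * w) := fun x hx =>
    Finset.mem_image.2 ⟨x * w⁻¹, hK t x w hx, by simp⟩
  let f : G →₀ ℂ := Finsupp.onFinset (K.image (· * w)) φ hsupp
  have hf : ∀ x, f x = φ x := fun x => rfl
  have hsum : ∀ (b : G → ℂ), ∑ y ∈ f.support, b y * f y = ∑ v ∈ K, b (v * w) * φ (v * w) := by
    intro b
    rw [← Finset.sum_image (s := K) (g := (· * w)) (f := fun y => b y * φ y)
      (fun x _ y _ h => mul_right_cancel h)]
    refine Finset.sum_subset Finsupp.support_onFinset_subset fun x _ hx => ?_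
    rw [Finsupp.notMem_support_iff.1 hx, mul_zero]
  have happly : ∀ x, bandApply F t φ x = ∑ v ∈ K, t x (v * w) * φ (v * w) := by
    intro x
    have h1 : ∑' y, t x y * φ y = bandApply F t φ x := by
      rw [← (Equiv.mulRight x).tsum_eq, tsum_eq_sum (s := F)]
      · rfl
      · intro v hv
        by_contra hne
        exact hv (by simpa using trunc_ne_zero hF (left_ne_zero_of_mul hne))
    have h2 : ∑' y, t x y * φ y = ∑ v ∈ K, t x (v * w) * φ (v * w) := by
      rw [← (Equiv.mulRight w).tsum_eq, tsum_eq_sum (s := K)]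
      · rfl
      · intro v hv
        by_contra hne
        exact hv (by simpa using hK t _ _ (right_ne_zero_of_mul hne))
    rw [← h1, h2]
  set R := (algebraMap ℂ _ z - T) * aeval T p - 1 with hR
  have hRapp : ∀ x, R (lp.single 2 w (1 : ℂ)) x
      = z * φ x - bandApply F t φ x - (Pi.single w 1 : G → ℂ) x := by
    intro x
    have h1 : ∀ x, aeval T p (lp.single 2 w (1 : ℂ)) x = φ x := fun x =>
      aeval_single_apply hTapp p x w
    have h2 : R (lp.single 2 w (1 : ℂ)) = z • aeval T p (lp.single 2 w (1 : ℂ))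
        - T (aeval T p (lp.single 2 w (1 : ℂ))) - lp.single 2 w (1 : ℂ) := by
      simp [hR, Algebra.algebraMap_eq_smul_one, sub_mul]
    rw [h2, lp.coeFn_sub, lp.coeFn_sub, lp.coeFn_smul]
    simp only [Pi.sub_apply, Pi.smul_apply, hTapp, smul_eq_mul, lp.coeFn_single, h1]
    have : ⇑(aeval T p (lp.single 2 w (1 : ℂ))) = φ := funext h1
    rw [this]
  refine ⟨f, ?_⟩
  have hdecomp : ∀ g, (Pi.single w 1 : G → ℂ) g - (z * f g - ∑ y ∈ f.support, m g y * f y)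
      = -R (lp.single 2 w (1 : ℂ)) g + truncError n F K p m g w := by
    intro g
    rw [hsum, hf, hRapp, happly, truncError]
    simp only [sub_mul, Finset.sum_sub_distrib]
    ring
  simp_rw [hdecomp]
  refine (tsum_enorm_add_sq_le _ _).trans ?_
  gcongr
  simp_rw [enorm_neg, tsum_enorm_sq_eq]
  gcongr
  rw [← ofReal_norm]
  refine ENNReal.ofReal_le_ofReal ((R.le_opNorm _).trans ?_)
  rw [lp.norm_single (by norm_num), norm_one, mul_one]
  exact hp T hT hTn

end Truncation

section Probability

lemma measurable_entry {ι : Type*} (x y : ι) : Measurable fun m : ι → ι → ℂ => m x y := by fun_prop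

lemma measurable_shift {G : Type*} [Group G] (z : G) :
    Measurable (shift z : (G → G → ℂ) → G → G → ℂ) :=
  measurable_pi_lambda _ fun x => measurable_pi_lambda _ fun y => measurable_entry (x * z) (y * z)

lemma measurable_colSum {ι : Type*} [Countable ι] (x : ι) :
    Measurable fun m : ι → ι → ℂ => colSum m x :=
  Measurable.tsum fun u => (measurable_entry u x).enorm

variable {G : Type*} [Group G] [Countable G]

lemma measurable_trunc (n : ℕ) (F : Finset G) (x y : G) :
    Measurable fun m : G → G → ℂ => trunc n F m x y := by
  refine Measurable.ite ?_ (measurable_entry x y) measurable_const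
  refine (MeasurableSet.const _).inter (MeasurableSet.inter ?_ ?_)
  · exact measurableSet_le (measurable_colSum x) measurable_const
  · exact measurableSet_le (measurable_colSum y) measurable_const

lemma measurable_bandPow_trunc (n : ℕ) (F : Finset G) (k : ℕ) (x y : G) :
    Measurable fun m : G → G → ℂ => bandPow F (trunc n F m) k x y := by
  induction k generalizing x with
  | zero => exact measurable_const
  | succ k ih => exact Finset.measurable_fun_sum _ fun v _ => (measurable_trunc n F _ _).mul (ih _)

lemma measurable_truncError (n : ℕ) (F K : Finset G) (p : ℂ[X]) (x y : G) :
    Measurable fun m : G → G → ℂ => truncError n F K p m x y :=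
  Finset.measurable_fun_sum _ fun _ _ => ((measurable_entry _ _).sub (measurable_trunc n F _ _)).mul
    (Finset.measurable_fun_sum _ fun _ _ =>
      measurable_const.mul (measurable_bandPow_trunc n F _ _ _))

variable {μ : Measure (G → G → ℂ)}

/-- For a translation invariant law, the expected square norms of the column and of the row of
`truncError` coincide. -/
lemma lintegral_truncError_col (hμ : ∀ z, MeasurePreserving (shift z) μ μ) (n : ℕ)
    (F K : Finset G) (p : ℂ[X]) (w : G) :
    ∫⁻ m, ∑' x, ‖truncError n F K p m x w‖ₑ ^ 2 ∂μ
      = ∫⁻ m, ∑' x, ‖truncError n F K p m w x‖ₑ ^ 2 ∂μ := by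
  have hmeas : ∀ x y, Measurable fun m : G → G → ℂ => ‖truncError n F K p m x y‖ₑ ^ 2 :=
    fun x y => (measurable_truncError n F K p x y).enorm.pow_const 2
  rw [lintegral_tsum fun x => (hmeas x w).aemeasurable,
    lintegral_tsum fun x => (hmeas w x).aemeasurable,
    ← (((Equiv.inv G).trans (Equiv.mulLeft w)).trans (Equiv.mulRight w)).tsum_eq]
  refine tsum_congr fun x => ?_
  have h := (hμ (w⁻¹ * x)).lintegral_comp (hmeas (w * x⁻¹ * w) w)
  simp only [truncError_shift, mul_assoc, mul_inv_cancel_left, inv_mul_cancel, mul_one] at h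
  simpa [mul_assoc] using h.symm

lemma lintegral_colSum_sq (hμ : ∀ z, MeasurePreserving (shift z) μ μ) (x : G) :
    ∫⁻ m, colSum m x ^ 2 ∂μ = ∫⁻ m, colSum m 1 ^ 2 ∂μ := by
  rw [← (hμ x).lintegral_comp ((measurable_colSum 1).pow_const 2)]
  simp [colSum_shift]

lemma ae_colSum_lt_top (hμ : ∀ z, MeasurePreserving (shift z) μ μ)
    (hmom : ∫⁻ m, colSum m 1 ^ 2 ∂μ < ⊤) : ∀ᵐ m ∂μ, ∀ x, colSum m x < ⊤ := by
  rw [ae_all_iff]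
  intro x
  have := ae_lt_top ((measurable_colSum x).pow_const 2)
    ((lintegral_colSum_sq hμ x).trans_lt hmom).ne
  filter_upwards [this] with m hm
  simpa using hm

lemma tendsto_tsum_enorm_sub_trunc {F : ℕ → Finset G}
    (hF : ∀ g, ∀ᶠ n in Filter.atTop, g ∈ F n) {m : G → G → ℂ} (hm : ∀ x, colSum m x < ⊤) (w : G) :
    Filter.Tendsto (fun n : ℕ => ∑' u, ‖m u w - trunc n (F n) m u w‖ₑ ^ 2) Filter.atTop
      (nhds 0) := by
  let _ : MeasurableSpace G := ⊤
  have hlarge : ∀ x, ∀ᶠ n : ℕ in Filter.atTop, colSum m x ≤ n := fun x => by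
    obtain ⟨N, hN⟩ := ENNReal.exists_nat_gt (hm x).ne
    filter_upwards [Filter.eventually_ge_atTop N] with n hn
    exact hN.le.trans (by exact_mod_cast hn)
  simp_rw [← lintegral_count]
  rw [← lintegral_zero (μ := (Measure.count : Measure G))]
  refine tendsto_lintegral_of_dominated_convergence (fun u => ‖m u w‖ₑ ^ 2)
    (fun n => measurable_from_top) (fun n => Filter.Eventually.of_forall fun u => ?_) ?_
    (Filter.Eventually.of_forall fun u => ?_)
  · exact pow_le_pow_left₀ zero_le (enorm_sub_trunc_le n (F n) m u w) 2
  · rw [lintegral_count]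
    exact ne_top_of_le_ne_top (ENNReal.pow_ne_top (hm w).ne) (tsum_sq_le_sq_tsum _)
  · refine tendsto_const_nhds.congr' ?_
    filter_upwards [hF (u * w⁻¹), hlarge u, hlarge w] with n h1 h2 h3
    simp [trunc, h1, h2, h3]

lemma tendsto_lintegral_sub_trunc (hμ : ∀ z, MeasurePreserving (shift z) μ μ)
    (hmom : ∫⁻ m, colSum m 1 ^ 2 ∂μ < ⊤) {F : ℕ → Finset G}
    (hF : ∀ g, ∀ᶠ n in Filter.atTop, g ∈ F n) (w : G) :
    Filter.Tendsto (fun n : ℕ => ∫⁻ m, ∑' u, ‖m u w - trunc n (F n) m u w‖ₑ ^ 2 ∂μ) Filter.atTop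
      (nhds 0) := by
  rw [← lintegral_zero (μ := μ)]
  refine tendsto_lintegral_of_dominated_convergence (fun m => colSum m w ^ 2)
    (fun n => Measurable.tsum fun u =>
      ((measurable_entry u w).sub (measurable_trunc n (F n) u w)).enorm.pow_const 2)
    (fun n => Filter.Eventually.of_forall fun m => tsum_enorm_sub_trunc_sq_le n (F n) m w)
    ((lintegral_colSum_sq hμ w).trans_lt hmom).ne ?_
  filter_upwards [ae_colSum_lt_top hμ hmom] with m hm
  exact tendsto_tsum_enorm_sub_trunc hF hm w

lemma exists_symmetric_exhaustion (G : Type*) [Group G] [Countable G] :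
    ∃ F : ℕ → Finset G, (∀ n, ∀ g ∈ F n, g⁻¹ ∈ F n) ∧ ∀ g, ∀ᶠ n in Filter.atTop, g ∈ F n := by
  obtain ⟨e, he⟩ := exists_surjective_nat G
  refine ⟨fun n => (Finset.range n).image e ∪ (Finset.range n).image fun k => (e k)⁻¹, ?_, ?_⟩
  · intro n g hg
    simp only [Finset.mem_union, Finset.mem_image] at hg ⊢
    rcases hg with ⟨k, hk, rfl⟩ | ⟨k, hk, rfl⟩
    · exact Or.inr ⟨k, hk, rfl⟩
    · exact Or.inl ⟨k, hk, by simp⟩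
  · intro g
    obtain ⟨k, rfl⟩ := he g
    filter_upwards [Filter.eventually_gt_atTop k] with n hn
    exact Finset.mem_union_left _ (Finset.mem_image_of_mem _ (Finset.mem_range.2 hn))

/-- For a hermitian random matrix with a translation invariant law, almost surely `δ_w` is in the
closure of the range of `z - A`. -/
lemma ae_single_mem_closure (hμ : ∀ z, MeasurePreserving (shift z) μ μ)
    (hmom : ∫⁻ m, colSum m 1 ^ 2 ∂μ < ⊤)
    (hherm : ∀ᵐ m ∂μ, ∀ x y, m x y = starRingEnd ℂ (m y x)) {z : ℂ} (hz : z.im ≠ 0) (w : G) :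
    ∀ᵐ m ∂μ, ∀ ε : ℝ≥0∞, 0 < ε → ∃ f : G →₀ ℂ,
      ∑' g, ‖(Pi.single w 1 : G → ℂ) g - (z * f g - ∑ y ∈ f.support, m g y * f y)‖ₑ ^ 2 < ε := by
  obtain ⟨F, hFs, hF⟩ := exists_symmetric_exhaustion G
  have hpos : ∀ n : ℕ, (0 : ℝ) < 1 / (n + 1) := fun n => Nat.one_div_pos_of_nat
  choose p hp using fun n : ℕ => exists_polynomial_resolvent
    (A := lp (fun _ : G => ℂ) 2 →L[ℂ] lp (fun _ : G => ℂ) 2) z hz n (1 / (n + 1)) (hpos n)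
  choose K hK using fun n : ℕ => exists_bandPoly_support (F n) (p n)
  let D : ℕ → (G → G → ℂ) → ℝ≥0∞ := fun n m => ∑' x, ‖truncError n (F n) (K n) (p n) m x w‖ₑ ^ 2
  have hDmeas : ∀ n, Measurable (D n) := fun n => Measurable.tsum fun x =>
    (measurable_truncError n (F n) (K n) (p n) x w).enorm.pow_const 2
  set c := 2 / |z.im|
  have hc : 0 < c := by positivity
  have hDle : ∀ n, ∫⁻ m, D n m ∂μ
      ≤ ENNReal.ofReal c ^ 2 * ∫⁻ m, ∑' u, ‖m u w - trunc n (F n) m u w‖ₑ ^ 2 ∂μ := by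
    intro n
    rw [lintegral_truncError_col hμ, ← lintegral_const_mul' _ _ (by simp)]
    refine lintegral_mono_ae ?_
    filter_upwards [hherm] with m hm
    exact tsum_enorm_truncError_row_sq_le (hFs n) (hK n) hc (fun T hT hTn => (hp n T hT hTn).1) hm w
  have hDlim : Filter.Tendsto (fun n => ∫⁻ m, D n m ∂μ) Filter.atTop (nhds 0) := by
    refine tendsto_of_tendsto_of_tendsto_of_le_of_le tendsto_const_nhds ?_ (fun _ => zero_le) hDle
    simpa using ENNReal.Tendsto.const_mul (tendsto_lintegral_sub_trunc hμ hmom hF w)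
      (Or.inr (by simp : ENNReal.ofReal c ^ 2 ≠ ⊤))
  have hliminf : ∀ᵐ m ∂μ, Filter.liminf (fun n => D n m) Filter.atTop = 0 := by
    have h1 : ∫⁻ m, Filter.liminf (fun n => D n m) Filter.atTop ∂μ = 0 :=
      le_antisymm ((lintegral_liminf_le hDmeas).trans_eq hDlim.liminf_eq) zero_le
    exact (lintegral_eq_zero_iff (Measurable.liminf hDmeas)).1 h1
  filter_upwards [hliminf, hherm] with m hm hmherm ε hε
  have hεlim : Filter.Tendsto (fun n : ℕ => 2 * ENNReal.ofReal (1 / (n + 1)) ^ 2) Filter.atTop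
      (nhds 0) := by
    have h1 := ENNReal.tendsto_ofReal tendsto_one_div_add_atTop_nhds_zero_nat
    have h2 := ENNReal.Tendsto.const_mul (ENNReal.Tendsto.pow (n := 2) h1)
      (Or.inr (by simp : (2 : ℝ≥0∞) ≠ ⊤))
    simpa using h2
  have hε2 : 0 < ε / 2 := ENNReal.half_pos hε.ne'
  have hε4 : 0 < ε / 2 / 2 := ENNReal.half_pos hε2.ne'
  have hfreq : ∃ᶠ n in Filter.atTop, D n m < ε / 2 / 2 :=
    Filter.frequently_lt_of_liminf_lt (by isBoundedDefault) (hm.trans_lt hε4)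
  obtain ⟨n, hn1, hn2⟩ := (hfreq.and_eventually (hεlim.eventually_lt_const hε2)).exists
  obtain ⟨f, hf⟩ := exists_finsupp_approx (hFs n) (hK n) (fun T hT hTn => (hp n T hT hTn).2)
    hmherm w
  refine ⟨f, hf.trans_lt ?_⟩
  have h2 : 2 * D n m < ε / 2 := by
    rw [mul_comm]
    exact (ENNReal.lt_div_iff_mul_lt (by simp) (by simp)).1 hn1
  rw [mul_add, ← ENNReal.add_halves ε]
  exact ENNReal.add_lt_add hn2 h2

end Probability

section Deficiency

/-- If `z - L` has dense range for a symmetric operator `L`, so has `w - L` for `w` close to `z`. -/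
lemma dense_range_sub_of_near {V H : Type*} [AddCommGroup V] [Module ℂ V] [NormedAddCommGroup H]
    [InnerProductSpace ℂ H] [CompleteSpace H] (J L : V →ₗ[ℂ] H)
    (hsym : ∀ f g, inner ℂ (L f) (J g) = inner ℂ (J f) (L g)) {z w : ℂ} (hzw : ‖z - w‖ < |z.im|)
    (hz : (z • J - L).range.topologicalClosure = ⊤) :
    (w • J - L).range.topologicalClosure = ⊤ := by
  have him : 0 < |z.im| := (norm_nonneg _).trans_lt hzw
  have hbound : ∀ f, |z.im| * ‖J f‖ ≤ ‖(z • J - L) f‖ := by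
    intro f
    have h0 : (inner ℂ (J f) (L f)).im = 0 := by
      rw [← Complex.conj_eq_iff_im, inner_conj_symm, hsym]
    have h1 : (inner ℂ (J f) ((z • J - L) f)).im = z.im * ‖J f‖ ^ 2 := by
      rw [LinearMap.sub_apply, LinearMap.smul_apply, inner_sub_right, inner_smul_right,
        inner_self_eq_norm_sq_to_K, Complex.sub_im, h0, sub_zero]
      exact (congrArg (fun t : ℂ => (z * t).im) (Complex.ofReal_pow _ 2).symm).trans
        (Complex.im_mul_ofReal _ _)
    have h2 := (Complex.abs_im_le_norm _).trans (norm_inner_le_norm (𝕜 := ℂ) (J f) ((z • J - L) f))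
    rw [h1, abs_mul, abs_of_nonneg (sq_nonneg ‖J f‖)] at h2
    rcases (norm_nonneg (J f)).eq_or_lt with h | h
    · rw [← h, mul_zero]
      exact norm_nonneg _
    · nlinarith
  rw [Submodule.topologicalClosure_eq_top_iff, Submodule.eq_bot_iff]
  intro g hg
  set c := ‖z - w‖ / |z.im|
  have hc : c < 1 := (div_lt_one him).2 hzw
  have hclosed : IsClosed {u : H | ‖inner ℂ u g‖ ≤ c * ‖u‖ * ‖g‖} :=
    isClosed_le (by fun_prop) (by fun_prop)
  have hsub : ((z • J - L).range : Set H) ⊆ {u : H | ‖inner ℂ u g‖ ≤ c * ‖u‖ * ‖g‖} := by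
    rintro _ ⟨f, rfl⟩
    have h1 : inner ℂ ((w • J - L) f) g = 0 := (Submodule.mem_orthogonal _ _).1 hg _ ⟨f, rfl⟩
    have h2 : (z • J - L) f = (w • J - L) f + (z - w) • J f := by
      simp [sub_smul]
    have h3 : inner ℂ ((z • J - L) f) g = inner ℂ ((z - w) • J f) g := by
      rw [h2, inner_add_left, h1, zero_add]
    rw [Set.mem_ofPred_eq, h3]
    calc _ ≤ ‖(z - w) • J f‖ * ‖g‖ := norm_inner_le_norm _ _
      _ = c * (|z.im| * ‖J f‖) * ‖g‖ := by
        rw [norm_smul, ← mul_assoc, div_mul_cancel₀ _ him.ne']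
      _ ≤ _ := by
        gcongr
        exact hbound f
  have hmem : g ∈ {u : H | ‖inner ℂ u g‖ ≤ c * ‖u‖ * ‖g‖} := by
    have : g ∈ (z • J - L).range.topologicalClosure := hz ▸ Submodule.mem_top
    exact closure_minimal hsub hclosed this
  rw [Set.mem_ofPred_eq, inner_self_eq_norm_sq_to_K] at hmem
  simp only [norm_pow, Complex.coe_algebraMap, Complex.norm_real, norm_norm] at hmem
  by_contra hne
  have := norm_pos_iff.2 hne
  nlinarith [mul_pos this this]

end Deficiency

section Matrix

variable {G : Type*}

lemma enorm_sq_lt_ofReal_sq {E : Type*} [SeminormedAddCommGroup E] (v : E) {ε : ℝ} (hε : 0 < ε) :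
    ‖v‖ₑ ^ 2 < ENNReal.ofReal (ε ^ 2) ↔ ‖v‖ < ε := by
  rw [← ofReal_norm, ← ENNReal.ofReal_pow (norm_nonneg _),
    ENNReal.ofReal_lt_ofReal_iff (by positivity), sq_lt_sq₀ (norm_nonneg _) hε.le]

/-- A hermitian matrix with summable columns defines a symmetric operator on finitely supported
functions, and this operator is essentially self-adjoint if all the delta functions are limits of
elements of the range of `z - m` for a dense set of non-real `z`. -/
lemma symmetric_and_dense_range {m : G → G → ℂ} (hm : ∀ x y, m x y = starRingEnd ℂ (m y x))
    (hcol : ∀ x, colSum m x < ⊤) {D : Set ℂ} (hD : Dense D)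
    (hrange : ∀ z ∈ D, z.im ≠ 0 → ∀ w, ∀ ε : ℝ≥0∞, 0 < ε → ∃ f : G →₀ ℂ,
      ∑' g, ‖(Pi.single w 1 : G → ℂ) g - (z * f g - ∑ y ∈ f.support, m g y * f y)‖ₑ ^ 2 < ε) :
    (∀ f : G →₀ ℂ, Memℓp (fun g : G => ∑ y ∈ f.support, m g y * f y) 2) ∧
    (∀ f h : G →₀ ℂ, ∑' g : G, starRingEnd ℂ (∑ y ∈ f.support, m g y * f y) * h g
      = ∑' g : G, starRingEnd ℂ (f g) * (∑ y ∈ h.support, m g y * h y)) ∧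
    (∀ z : ℂ, z.im ≠ 0 → ∀ ξ : G → ℂ, Memℓp ξ 2 → ∀ ε : ℝ, 0 < ε → ∃ f : G →₀ ℂ,
      ∑' g : G, ‖ξ g - (z * f g - ∑ y ∈ f.support, m g y * f y)‖ₑ ^ 2
        < ENNReal.ofReal (ε ^ 2)) := by
  have hcolmem : ∀ y, Memℓp (fun x => m x y) 2 := fun y =>
    memℓp_two_iff.2 (ne_top_of_le_ne_top (ENNReal.pow_ne_top (hcol y).ne) (tsum_sq_le_sq_tsum _))
  let col : G → lp (fun _ : G => ℂ) 2 := fun y => ⟨fun x => m x y, hcolmem y⟩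
  have hcolapp : ∀ y x, col y x = m x y := fun y x => rfl
  let δ : G → lp (fun _ : G => ℂ) 2 := fun y => lp.single 2 y (1 : ℂ)
  let L := Finsupp.linearCombination ℂ col
  let J := Finsupp.linearCombination ℂ δ
  have hL : ∀ f x, L f x = ∑ y ∈ f.support, m x y * f y := by
    intro f x
    simp only [L, Finsupp.linearCombination_apply, Finsupp.sum, lp.coeFn_sum, Finset.sum_apply,
      lp.coeFn_smul, Pi.smul_apply, hcolapp, smul_eq_mul, mul_comm]
  have hJ : ∀ f x, J f x = f x := by
    intro f x
    simp only [J, δ, Finsupp.linearCombination_apply, Finsupp.sum, lp.coeFn_sum, Finset.sum_apply,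
      lp.coeFn_smul, Pi.smul_apply, smul_eq_mul, lp.single_apply, Pi.single_apply]
    simp +contextual [eq_comm]
  have hsym : ∀ f g, inner ℂ (L f) (J g) = inner ℂ (J f) (L g) := by
    intro f g
    have : ∀ x y, inner ℂ (col x) (δ y) = inner ℂ (δ x) (col y) := by
      intro x y
      rw [lp.inner_single_left, lp.inner_single_right, hcolapp, hcolapp]
      simp [← hm]
    simp only [L, J, Finsupp.linearCombination_apply, Finsupp.sum, sum_inner, inner_sum,
      inner_smul_left, inner_smul_right, this]
  have hdiff : ∀ (z : ℂ) (v : lp (fun _ : G => ℂ) 2) (f : G →₀ ℂ),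
      ∑' g, ‖v g - (z * f g - ∑ y ∈ f.support, m g y * f y)‖ₑ ^ 2
        = ‖v - (z • J - L) f‖ₑ ^ 2 := by
    intro z v f
    rw [← tsum_enorm_sq_eq]
    refine tsum_congr fun g => ?_
    rw [LinearMap.sub_apply, LinearMap.smul_apply, lp.coeFn_sub, lp.coeFn_sub, lp.coeFn_smul]
    simp only [Pi.sub_apply, Pi.smul_apply, hL, hJ, smul_eq_mul]
  refine ⟨fun f => ?_, fun f h => ?_, fun z hz ξ hξ ε hε => ?_⟩
  · convert lp.memℓp (L f) using 1
    exact (funext (hL f)).symm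
  · have := hsym f h
    rw [lp.inner_eq_tsum, lp.inner_eq_tsum] at this
    simpa only [hL, hJ, RCLike.inner_apply, mul_comm] using this
  · have hopen : IsOpen {d : ℂ | ‖d - z‖ < |d.im|} :=
      isOpen_lt (by fun_prop) Complex.continuous_im.abs
    obtain ⟨d, hdD, hdz⟩ := hD.exists_mem_open hopen ⟨z, by simpa using hz⟩
    have hdim : d.im ≠ 0 := abs_pos.1 ((norm_nonneg _).trans_lt hdz)
    have hdense : (d • J - L).range.topologicalClosure = ⊤ := by
      rw [Submodule.topologicalClosure_eq_top_iff, Submodule.eq_bot_iff]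
      intro v hv
      rw [← Submodule.orthogonal_closure] at hv
      ext w
      have hw : δ w ∈ (d • J - L).range.topologicalClosure := by
        refine Metric.mem_closure_iff.2 fun ε hε => ?_
        obtain ⟨f, hf⟩ := hrange d hdD hdim w (ENNReal.ofReal (ε ^ 2)) (by positivity)
        refine ⟨_, ⟨f, rfl⟩, ?_⟩
        rw [dist_eq_norm, ← enorm_sq_lt_ofReal_sq _ hε, ← hdiff]
        simpa only [δ, lp.coeFn_single] using hf
      have := (Submodule.mem_orthogonal _ _).1 hv _ hw
      rw [lp.inner_single_left] at this
      simpa using this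
    have hzdense := dense_range_sub_of_near J L hsym hdz hdense
    let v : lp (fun _ : G => ℂ) 2 := ⟨ξ, hξ⟩
    have hv : v ∈ (z • J - L).range.topologicalClosure := hzdense ▸ Submodule.mem_top
    obtain ⟨_, ⟨f, rfl⟩, hf⟩ := Metric.mem_closure_iff.1 hv ε hε
    refine ⟨f, ?_⟩
    rw [dist_eq_norm, ← enorm_sq_lt_ofReal_sq _ hε, ← hdiff] at hf
    exact hf

end Matrix

section Law

variable {G : Type*} [Group G] {Ω : Type*} [MeasurableSpace Ω] {P : Measure Ω}
  [IsProbabilityMeasure P] {a : G → G → Ω → ℂ}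

lemma measurePreserving_shift_map (hmeas : ∀ x y : G, Measurable (a x y))
    (hinv : ∀ z : G, ∀ F : Finset G, ∀ E : Set ((F × F) → ℂ), MeasurableSet E →
      P {ω | (fun p : F × F => a (p.1 : G) (p.2 : G) ω) ∈ E}
        = P {ω | (fun p : F × F => a ((p.1 : G) * z) ((p.2 : G) * z) ω) ∈ E}) (z : G) :
    MeasurePreserving (shift z) (P.map fun ω x y => a x y ω) (P.map fun ω x y => a x y ω) := by
  refine ⟨measurable_shift z, ?_⟩
  have ha : Measurable fun ω x y => a x y ω :=
    measurable_pi_lambda _ fun x => measurable_pi_lambda _ fun y => hmeas x y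
  let X : G × G → Ω → ℂ := fun p => a p.1 p.2
  let Y : G × G → Ω → ℂ := fun p => a (p.1 * z) (p.2 * z)
  have hX : Measurable fun ω => (X · ω) := measurable_pi_lambda _ fun p => hmeas _ _
  have hY : Measurable fun ω => (Y · ω) := measurable_pi_lambda _ fun p => hmeas _ _
  have hXY : P.map (fun ω => (X · ω)) = P.map fun ω => (Y · ω) := by
    rw [ProbabilityTheory.map_eq_iff_forall_finset_map_restrict_eq hX.aemeasurable hY.aemeasurable]
    intro I
    ext E hE
    have hXI : Measurable fun ω => I.restrict (X · ω) := (Finset.measurable_restrict I).comp hX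
    have hYI : Measurable fun ω => I.restrict (Y · ω) := (Finset.measurable_restrict I).comp hY
    rw [Measure.map_apply hXI hE, Measure.map_apply hYI hE]
    let F : Finset G := I.image Prod.fst ∪ I.image Prod.snd
    have h1 : ∀ i : I, i.1.1 ∈ F := fun i =>
      Finset.mem_union_left _ (Finset.mem_image_of_mem _ i.2)
    have h2 : ∀ i : I, i.1.2 ∈ F := fun i =>
      Finset.mem_union_right _ (Finset.mem_image_of_mem _ i.2)
    let ρ : (F × F → ℂ) → I → ℂ := fun φ i => φ (⟨i.1.1, h1 i⟩, ⟨i.1.2, h2 i⟩)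
    have hρ : Measurable ρ := measurable_pi_lambda _ fun i => measurable_pi_apply _
    exact hinv z F (ρ ⁻¹' E) (hρ hE)
  have hcurry : Measurable (Function.curry : (G × G → ℂ) → G → G → ℂ) :=
    measurable_pi_lambda _ fun x => measurable_pi_lambda _ fun y => measurable_pi_apply (x, y)
  rw [Measure.map_map (measurable_shift z) ha]
  have h := congrArg (Measure.map Function.curry) hXY
  rw [Measure.map_map hcurry hX, Measure.map_map hcurry hY] at h
  exact h.symm

end Law

end RandomMatrix

/-- a symmetric, translation invariant in distribution random matrix (a(x,y)) over
a countably infinite group G with E[(∑_x |a(x,1)|)²] < ∞ almost surely defines, on the finitely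
supported functions D₀, a symmetric operator into ℓ²(G) which is essentially self-adjoint:
for each non-real z the set {z·f − Ãf : f ∈ D₀} is dense in ℓ²(G). -/
theorem random_matrix_essentially_selfAdjoint
    {G : Type*} [Group G] [Countable G] [Infinite G]
    {Ω : Type*} [MeasurableSpace Ω] (P : Measure Ω) [IsProbabilityMeasure P]
    (a : G → G → Ω → ℂ)
    (hmeas : ∀ x y : G, Measurable (a x y))
    (hsym : ∀ x y : G, ∀ ω : Ω, a x y ω = starRingEnd ℂ (a y x ω))
    (hinv : ∀ z : G, ∀ F : Finset G, ∀ E : Set ((F × F) → ℂ), MeasurableSet E →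
      P {ω | (fun p : F × F => a (p.1 : G) (p.2 : G) ω) ∈ E}
        = P {ω | (fun p : F × F => a ((p.1 : G) * z) ((p.2 : G) * z) ω) ∈ E})
    (hmom : ∫⁻ ω, (∑' x : G, (‖a x 1 ω‖₊ : ℝ≥0∞)) ^ 2 ∂P < ⊤) :
    ∃ Ω' : Set Ω, MeasurableSet Ω' ∧ P Ω' = 1 ∧ ∀ ω ∈ Ω',
      -- (i) well defined into ℓ²(G) …
      (∀ f : G →₀ ℂ, Memℓp (fun g : G => ∑ y ∈ f.support, a g y ω * f y) 2) ∧
      -- … and symmetric on D₀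
      (∀ f h : G →₀ ℂ,
        ∑' g : G, starRingEnd ℂ (∑ y ∈ f.support, a g y ω * f y) * h g
          = ∑' g : G, starRingEnd ℂ (f g) * (∑ y ∈ h.support, a g y ω * h y)) ∧
      -- (ii) essential self-adjointness: (z − Ã)(D₀) is dense in ℓ²(G) for non-real z
      (∀ z : ℂ, z.im ≠ 0 → ∀ ξ : G → ℂ, Memℓp ξ 2 → ∀ ε : ℝ, 0 < ε →
        ∃ f : G →₀ ℂ,
          (∑' g : G,
            (‖ξ g - (z * f g - ∑ y ∈ f.support, a g y ω * f y)‖₊ : ℝ≥0∞) ^ 2)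
            < ENNReal.ofReal (ε ^ 2)) := by
  have ha : Measurable fun ω x y => a x y ω :=
    measurable_pi_lambda _ fun x => measurable_pi_lambda _ fun y => hmeas x y
  have hμ := RandomMatrix.measurePreserving_shift_map hmeas hinv
  have hmom' : ∫⁻ m, RandomMatrix.colSum m 1 ^ 2 ∂(P.map fun ω x y => a x y ω) < ⊤ := by
    rw [lintegral_map ((RandomMatrix.measurable_colSum 1).pow_const 2) ha]
    exact hmom
  have hherm : ∀ᵐ m ∂(P.map fun ω x y => a x y ω), ∀ x y, m x y = starRingEnd ℂ (m y x) := by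
    simp only [ae_all_iff]
    intro x y
    refine (ae_map_iff ha.aemeasurable ?_).2 (Filter.Eventually.of_forall fun ω => hsym x y ω)
    exact measurableSet_eq_fun (RandomMatrix.measurable_entry x y)
      (Complex.continuous_conj.measurable.comp (RandomMatrix.measurable_entry y x))
  obtain ⟨D, hDc, hD⟩ := TopologicalSpace.exists_countable_dense ℂ
  have hcol := ae_of_ae_map ha.aemeasurable (RandomMatrix.ae_colSum_lt_top hμ hmom')
  classical
  have hrange : ∀ᵐ ω ∂P, ∀ z ∈ D, z.im ≠ 0 → ∀ w, ∀ ε : ℝ≥0∞, 0 < ε → ∃ f : G →₀ ℂ,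
      ∑' g, ‖(Pi.single w 1 : G → ℂ) g
        - (z * f g - ∑ y ∈ f.support, a g y ω * f y)‖ₑ ^ 2 < ε := by
    refine (ae_ball_iff hDc).2 fun z _ => ?_
    by_cases hz : z.im = 0
    · exact Filter.Eventually.of_forall fun ω h => absurd hz h
    · filter_upwards [ae_all_iff.2 fun w => ae_of_ae_map ha.aemeasurable
        (RandomMatrix.ae_single_mem_closure hμ hmom' hherm hz w)] with ω hω _ using hω
  obtain ⟨Ω', hΩ', hmeasΩ', hgood⟩ := (hcol.and hrange).exists_measurable_mem
  refine ⟨Ω', hmeasΩ', (mem_ae_iff_prob_eq_one hmeasΩ').1 hΩ', fun ω hω => ?_⟩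
  exact RandomMatrix.symmetric_and_dense_range (hsym · · ω) (hgood ω hω).1 hD (hgood ω hω).2
end

section
/- Let s ≥ 2, F_s the free group on generators a₁,…,a_s, n ∈ ℕ, and B_n the ball of radius n in F_s. For each letter x ∈ {a₁^{±1},…,a_s^{±1}} let p_x^{(n)} be the permutation of B_n defined by p_x^{(n)}(w) = x·w if |x·w| ≤ n, and p_x^{(n)}(w) = w₁⁻¹w₂⁻¹⋯w_m⁻¹ if |x·w| > n, where w₁⋯w_m is the reduced word of w. Let ρ_n : F_s → Sym(B_n) be the group homomorphism determined by ρ_n(a_i) = p_{a_i}^{(n)} for i = 1,…,s (so ρ_n(x) = p_x^{(n)} for every letter x). Then every w ∈ ker ρ_n with w ≠ 1 has word length |w| ≥ 2n + 1, and consequently ⋂_{n∈ℕ} ker ρ_n = {1}. -/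
/-- Letterwise inversion: maps a reduced word w₁w₂⋯w_m to w₁⁻¹w₂⁻¹⋯w_m⁻¹. -/
def flipWord {s : ℕ} (w : FreeGroup (Fin s)) : FreeGroup (Fin s) :=
  FreeGroup.mk (w.toWord.map fun p => (p.1, !p.2))

/-- The map p_x^{(n)} on the ball B_n of the free group: w ↦ x·w if |x·w| ≤ n, and
w = w₁⋯w_m ↦ w₁⁻¹⋯w_m⁻¹ otherwise. -/
def pFun {s : ℕ} (x : FreeGroup (Fin s)) (n : ℕ) (w : FreeGroup (Fin s)) :
    FreeGroup (Fin s) :=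
  if (x * w).norm ≤ n then x * w else flipWord w

/-- Words of length at most `n` send the identity to the group element they spell, since the orbit
never leaves the ball of radius `n`. -/
theorem apply_mk_one_of_length_le {s n : ℕ}
    (ρ : FreeGroup (Fin s) →* Equiv.Perm {w : FreeGroup (Fin s) // w.norm ≤ n})
    (hρ : ∀ x : FreeGroup (Fin s), x.norm = 1 →
      ∀ w : {w : FreeGroup (Fin s) // w.norm ≤ n},
        ((ρ x w : {w : FreeGroup (Fin s) // w.norm ≤ n}) : FreeGroup (Fin s))
          = pFun x n (w : FreeGroup (Fin s)))
    (e : {w : FreeGroup (Fin s) // w.norm ≤ n}) (he : (e : FreeGroup (Fin s)) = 1)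
    (L : List (Fin s × Bool)) (hL : L.length ≤ n) :
    (ρ (FreeGroup.mk L) e : FreeGroup (Fin s)) = FreeGroup.mk L := by
  induction L with
  | nil => simpa [← FreeGroup.one_eq_mk] using he
  | cons a L ih =>
    have hmul : FreeGroup.mk (a :: L) = FreeGroup.mk [a] * FreeGroup.mk L := by
      simp [FreeGroup.mul_mk]
    have hnorm : (FreeGroup.mk [a]).norm = 1 := by
      simp [FreeGroup.norm, FreeGroup.toWord_mk]
    have hle : (FreeGroup.mk [a] * FreeGroup.mk L).norm ≤ n :=
      hmul ▸ FreeGroup.norm_mk_le.trans hL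
    rw [hmul, map_mul, Equiv.Perm.mul_apply, hρ _ hnorm, ih ((Nat.le_succ _).trans hL), pFun,
      if_pos hle]

/-- if ρ_n : F_s → Sym(B_n) is the homomorphism with ρ_n(x) = p_x^{(n)} for every
letter x, then every nontrivial element of ker ρ_n has word length ≥ 2n + 1, and the
intersection of the kernels is trivial. -/
theorem freeGroup_sofic_kernels (s : ℕ) (hs : 2 ≤ s)
    (ρ : (n : ℕ) → FreeGroup (Fin s) →* Equiv.Perm {w : FreeGroup (Fin s) // w.norm ≤ n})
    (hρ : ∀ n : ℕ, ∀ x : FreeGroup (Fin s), x.norm = 1 →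
      ∀ w : {w : FreeGroup (Fin s) // w.norm ≤ n},
        ((ρ n x w : {w : FreeGroup (Fin s) // w.norm ≤ n}) : FreeGroup (Fin s))
          = pFun x n (w : FreeGroup (Fin s))) :
    (∀ n : ℕ, ∀ w : FreeGroup (Fin s), w ∈ (ρ n).ker → w ≠ 1 → 2 * n + 1 ≤ w.norm) ∧
    (∀ w : FreeGroup (Fin s), (∀ n : ℕ, w ∈ (ρ n).ker) → w = 1) := by
  have key : ∀ n : ℕ, ∀ w : FreeGroup (Fin s), w ∈ (ρ n).ker → w ≠ 1 → 2 * n + 1 ≤ w.norm := by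
    intro n w hw hw1
    by_contra! hlt
    refine hw1 ?_
    let e : {w : FreeGroup (Fin s) // w.norm ≤ n} := ⟨1, by simp⟩
    set u := FreeGroup.mk (w.toWord.take n) with hu
    set t := FreeGroup.mk (w.toWord.drop n) with ht
    have hwut : w = u * t := by
      rw [hu, ht, FreeGroup.mul_mk, List.take_append_drop, FreeGroup.mk_toWord]
    have hdrop : (w.toWord.drop n).length ≤ n := by
      rw [FreeGroup.norm] at hlt
      rw [List.length_drop]
      omega
    have hρu : (ρ n u e : FreeGroup (Fin s)) = u :=
      apply_mk_one_of_length_le (ρ n) (hρ n) e rfl _ (by simp)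
    have hρt : (ρ n t⁻¹ e : FreeGroup (Fin s)) = t⁻¹ := by
      rw [ht, FreeGroup.inv_mk]
      exact apply_mk_one_of_length_le (ρ n) (hρ n) e rfl _
        (by rwa [FreeGroup.invRev_length])
    have hρut : ρ n u = ρ n t⁻¹ := by
      rw [MonoidHom.mem_ker, hwut, map_mul] at hw
      rw [map_inv, eq_inv_of_mul_eq_one_left hw]
    have hut : u = t⁻¹ := by rw [← hρu, hρut, hρt]
    rw [hwut, hut, inv_mul_cancel]
  refine ⟨key, fun w hw => ?_⟩
  by_contra hw1
  have := key w.norm w (hw _) hw1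
  omega
end

section
/- Let s ≥ 2, F_s the free group on generators a₁,…,a_s, n ≥ 1, B_n the ball of radius n in F_s, and for a letter x ∈ {a₁^{±1},…,a_s^{±1}} let p_x^{(n)} be the permutation of B_n defined by p_x^{(n)}(w) = x·w if |x·w| ≤ n and p_x^{(n)}(w) = w₁⁻¹⋯w_m⁻¹ otherwise (w₁⋯w_m the reduced word of w). Then: (i) the cycle (orbit) of the empty word ε under p_x^{(n)} has length exactly 2n + 1; in particular (p_x^{(n)})^{2n+1}(ε) = ε and (p_x^{(n)})^{j}(ε) ≠ ε for 1 ≤ j ≤ 2n; (ii) if w ∈ B_n is a reduced word of length m with 1 ≤ m ≤ n whose first letter w₁ satisfies w₁ ∉ {x, x⁻¹}, then the cycle of w under p_x^{(n)} has length exactly 4(n − m) + 2. -/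
/-- The empty word ε as an element of the ball B_n. -/
def epsBall (s n : ℕ) : {w : FreeGroup (Fin s) // w.norm ≤ n} :=
  ⟨1, by simp [FreeGroup.norm_one]⟩

open FreeGroup (mk_toWord toWord_mk toWord_inv toWord_injective isReduced_toWord
  norm_inv_eq inv_mk invRev)

theorem flipWord_mul {s : ℕ} (u v : FreeGroup (Fin s)) :
    flipWord (u * v) = flipWord u * flipWord v := by
  have key : ∀ w : FreeGroup (Fin s),
      flipWord w = FreeGroup.lift (fun i => (FreeGroup.of i)⁻¹) w := by
    have aux : ∀ L : List (Fin s × Bool), FreeGroup.mk (L.map fun p => (p.1, !p.2)) =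
        FreeGroup.lift (fun i => (FreeGroup.of i)⁻¹) (FreeGroup.mk L) := by
      intro L
      induction L with
      | nil => exact (map_one _).symm
      | cons a L ih =>
        have hcons : ∀ (b : Fin s × Bool) M, FreeGroup.mk (b :: M) =
            FreeGroup.mk [b] * FreeGroup.mk M := fun b M => rfl
        rw [List.map_cons, hcons, hcons a, map_mul, ih]
        congr 1
        obtain ⟨i, _ | _⟩ := a <;> simp [FreeGroup.of, invRev]
    intro w
    rw [flipWord, aux, mk_toWord]
  simp only [key, map_mul]

theorem toWord_flipWord {s : ℕ} (w : FreeGroup (Fin s)) :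
    (flipWord w).toWord = w.toWord.map fun p => (p.1, !p.2) := by
  rw [flipWord, toWord_mk]
  apply FreeGroup.IsReduced.reduce_eq
  have h : FreeGroup.IsReduced w.toWord := isReduced_toWord
  rw [FreeGroup.IsReduced, List.isChain_map]
  simpa [FreeGroup.IsReduced] using h

theorem norm_flipWord {s : ℕ} (w : FreeGroup (Fin s)) : (flipWord w).norm = w.norm := by
  simp [FreeGroup.norm, toWord_flipWord]

theorem flipWord_one {s : ℕ} : flipWord (1 : FreeGroup (Fin s)) = 1 := by
  have h := flipWord_mul (1 : FreeGroup (Fin s)) 1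
  simpa using h

theorem flipWord_flipWord {s : ℕ} (w : FreeGroup (Fin s)) : flipWord (flipWord w) = w := by
  apply toWord_injective
  simp [toWord_flipWord, Function.comp_def]

theorem flipWord_ne_self {s : ℕ} {w : FreeGroup (Fin s)} (hw : w.norm ≠ 0) :
    flipWord w ≠ w := by
  intro h
  have h2 := toWord_flipWord w
  rw [h] at h2
  cases hL : w.toWord with
  | nil => exact hw (by simp [FreeGroup.norm, hL])
  | cons a L =>
    rw [hL, List.map_cons, List.cons.injEq] at h2
    have := congrArg Prod.snd h2.1
    simp at this

theorem flipWord_zpow_letter {s : ℕ} {x : FreeGroup (Fin s)} (hx : x.norm = 1) (k : ℤ) :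
    flipWord (x ^ k) = x ^ (-k) := by
  have hx' : flipWord x = x⁻¹ := by
    obtain ⟨a, ha⟩ := List.length_eq_one_iff.mp hx
    apply toWord_injective
    simp [toWord_flipWord, toWord_inv, ha, invRev]
  let φ : FreeGroup (Fin s) →* FreeGroup (Fin s) := ⟨⟨flipWord, flipWord_one⟩, flipWord_mul⟩
  have h : φ (x ^ k) = φ x ^ k := map_zpow φ x k
  have h2 : flipWord (x ^ k) = flipWord x ^ k := h
  rw [h2, hx', inv_zpow, zpow_neg]

theorem norm_pow_letter_mul {s : ℕ} {x w : FreeGroup (Fin s)} (hx : x.norm = 1)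
    (hw : ∀ l ∈ w.toWord.head?, FreeGroup.mk [l] ≠ x⁻¹) (k : ℕ) :
    (x ^ k * w).norm = k + w.norm := by
  obtain ⟨a, ha⟩ := List.length_eq_one_iff.mp hx
  have hxa : x = FreeGroup.mk [a] := by rw [← ha, mk_toWord]
  have hpow : ∀ k : ℕ, x ^ k * w = FreeGroup.mk (List.replicate k a ++ w.toWord) := by
    intro k
    induction k with
    | zero => simp [mk_toWord]
    | succ k ih => rw [pow_succ', mul_assoc, ih, hxa]; rfl
  have hred : FreeGroup.IsReduced (List.replicate k a ++ w.toWord) := by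
    refine List.isChain_append.mpr ⟨List.isChain_replicate_of_rel k fun _ => rfl,
      isReduced_toWord, ?_⟩
    intro b hb l hl hbl
    obtain rfl : b = a := List.eq_of_mem_replicate (List.mem_of_mem_getLast? hb)
    by_contra hne
    apply hw l hl
    rw [hxa, inv_mk]
    obtain ⟨i, c⟩ := b
    obtain ⟨j, d⟩ := l
    simp only at hbl hne
    subst hbl
    cases c <;> cases d <;> simp_all [invRev]
  rw [hpow, FreeGroup.norm, toWord_mk, hred.reduce_eq]
  simp [FreeGroup.norm]

theorem norm_zpow_letter_mul {s : ℕ} {x w : FreeGroup (Fin s)} (hx : x.norm = 1)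
    (hw : ∀ l ∈ w.toWord.head?, FreeGroup.mk [l] ≠ x ∧ FreeGroup.mk [l] ≠ x⁻¹) (k : ℤ) :
    (x ^ k * w).norm = k.natAbs + w.norm := by
  obtain ⟨k, rfl | rfl⟩ := k.eq_nat_or_neg
  · simpa using norm_pow_letter_mul hx (fun l hl => (hw l hl).2) k
  · have hx' : (x⁻¹).norm = 1 := by rwa [norm_inv_eq]
    simpa using norm_pow_letter_mul hx' (fun l hl => by simpa using (hw l hl).1) k

section Orbit

variable {s n : ℕ} {x : FreeGroup (Fin s)}

theorem pFun_iterate_zpow_mul {u : FreeGroup (Fin s)}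
    (hu : ∀ k : ℤ, (x ^ k * u).norm = k.natAbs + u.norm) {r : ℕ} (hr : r + u.norm = n)
    {j : ℕ} (hj : j ≤ 2 * r) :
    (pFun x n)^[j] (x ^ (-(r : ℤ)) * u) = x ^ (-(r : ℤ) + j) * u := by
  induction j with
  | zero => simp
  | succ j ih =>
    have hstep : x * (x ^ (-(r : ℤ) + j) * u) = x ^ (-(r : ℤ) + (j + 1 : ℕ)) * u := by
      rw [← mul_assoc, ← zpow_one_add]
      congr 2
      push_cast
      ring
    rw [Function.iterate_succ_apply', ih (by omega), pFun, hstep, if_pos]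
    rw [hu]
    omega

theorem pFun_iterate_half_turn (hx : x.norm = 1) {u : FreeGroup (Fin s)}
    (hu : ∀ k : ℤ, (x ^ k * u).norm = k.natAbs + u.norm) {r : ℕ} (hr : r + u.norm = n) :
    (pFun x n)^[2 * r + 1] (x ^ (-(r : ℤ)) * u) = x ^ (-(r : ℤ)) * flipWord u := by
  have hmid : -(r : ℤ) + (2 * r : ℕ) = r := by push_cast; ring
  rw [Function.iterate_succ_apply', pFun_iterate_zpow_mul hu hr le_rfl, hmid, pFun, if_neg,
    flipWord_mul, flipWord_zpow_letter hx]
  rw [← mul_assoc, ← zpow_one_add, hu]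
  omega

theorem norm_zpow_mul_flipWord (hx : x.norm = 1) {u : FreeGroup (Fin s)}
    (hu : ∀ k : ℤ, (x ^ k * u).norm = k.natAbs + u.norm) (k : ℤ) :
    (x ^ k * flipWord u).norm = k.natAbs + (flipWord u).norm := by
  have h : x ^ k * flipWord u = flipWord (x ^ (-k) * u) := by
    rw [flipWord_mul, flipWord_zpow_letter hx, neg_neg]
  rw [h, norm_flipWord, norm_flipWord, hu, Int.natAbs_neg]

theorem pFun_iterate_full_turn (hx : x.norm = 1) {u : FreeGroup (Fin s)}
    (hu : ∀ k : ℤ, (x ^ k * u).norm = k.natAbs + u.norm) {r : ℕ} (hr : r + u.norm = n) :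
    (pFun x n)^[4 * r + 2] (x ^ (-(r : ℤ)) * u) = x ^ (-(r : ℤ)) * u := by
  have h : 4 * r + 2 = (2 * r + 1) + (2 * r + 1) := by ring
  rw [h, Function.iterate_add_apply, pFun_iterate_half_turn hx hu hr,
    pFun_iterate_half_turn hx (norm_zpow_mul_flipWord hx hu) (by rwa [norm_flipWord]),
    flipWord_flipWord]

theorem pFun_iterate_ne_of_le {u : FreeGroup (Fin s)}
    (hu : ∀ k : ℤ, (x ^ k * u).norm = k.natAbs + u.norm) {r : ℕ} (hr : r + u.norm = n)
    {j : ℕ} (hj₁ : 1 ≤ j) (hj₂ : j ≤ 2 * r) :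
    (pFun x n)^[j] (x ^ (-(r : ℤ)) * u) ≠ x ^ (-(r : ℤ)) * u := by
  rw [pFun_iterate_zpow_mul hu hr hj₂, zpow_add, mul_assoc]
  intro h
  have h2 := congrArg FreeGroup.norm (mul_left_cancel h)
  rw [hu] at h2
  omega

theorem pFun_iterate_ne_of_lt (hx : x.norm = 1) {u : FreeGroup (Fin s)} (hu₁ : u.norm ≠ 0)
    (hu : ∀ k : ℤ, (x ^ k * u).norm = k.natAbs + u.norm) {r : ℕ} (hr : r + u.norm = n)
    {j : ℕ} (hj₁ : 1 ≤ j) (hj₂ : j < 4 * r + 2) :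
    (pFun x n)^[j] (x ^ (-(r : ℤ)) * u) ≠ x ^ (-(r : ℤ)) * u := by
  rcases le_or_gt j (2 * r) with hj | hj
  · exact pFun_iterate_ne_of_le hu hr hj₁ hj
  obtain ⟨i, rfl⟩ : ∃ i, j = i + (2 * r + 1) := ⟨j - (2 * r + 1), by omega⟩
  have hu' := norm_zpow_mul_flipWord hx hu
  rw [Function.iterate_add_apply, pFun_iterate_half_turn hx hu hr,
    pFun_iterate_zpow_mul hu' (by rwa [norm_flipWord]) (by omega), zpow_add, mul_assoc]
  intro h
  have h1 := mul_left_cancel h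
  have h2 := congrArg FreeGroup.norm h1
  rw [hu', norm_flipWord] at h2
  obtain rfl : i = 0 := by omega
  exact flipWord_ne_self hu₁ (by simpa using h1)

theorem perm_pow_eq_self_iff {σ : Equiv.Perm {w : FreeGroup (Fin s) // w.norm ≤ n}}
    (hσ : ∀ w, ((σ w : {w : FreeGroup (Fin s) // w.norm ≤ n}) : FreeGroup (Fin s))
      = pFun x n (w : FreeGroup (Fin s)))
    (w : {w : FreeGroup (Fin s) // w.norm ≤ n})
    (hw : ∀ k : ℤ, (x ^ k * (w : FreeGroup (Fin s))).norm = k.natAbs + w.1.norm)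
    {r : ℕ} (hr : r + w.1.norm = n) (j : ℕ) :
    (σ ^ j) w = w ↔
      (pFun x n)^[j] (x ^ (-(r : ℤ)) * w) = x ^ (-(r : ℤ)) * (w : FreeGroup (Fin s)) := by
  have hiter : ∀ (j : ℕ) v, ((σ ^ j) v : FreeGroup (Fin s)) = (pFun x n)^[j] v := by
    intro j v
    induction j with
    | zero => rfl
    | succ j ih => rw [pow_succ', Equiv.Perm.mul_apply, hσ, ih, Function.iterate_succ_apply']
  let y : {w : FreeGroup (Fin s) // w.norm ≤ n} := ⟨x ^ (-(r : ℤ)) * w, by rw [hw]; omega⟩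
  have hy : (σ ^ r) y = w := by
    apply Subtype.ext
    rw [hiter, pFun_iterate_zpow_mul hw hr (by omega)]
    simp
  calc (σ ^ j) w = w ↔ (σ ^ r) ((σ ^ j) y) = (σ ^ r) y := by
        rw [← Equiv.Perm.mul_apply, ← pow_add, add_comm, pow_add, Equiv.Perm.mul_apply, hy]
    _ ↔ (σ ^ j) y = y := (σ ^ r).injective.eq_iff
    _ ↔ _ := by rw [Subtype.ext_iff, hiter]

end Orbit


/-- for a letter x and the permutation σ = p_x^{(n)} of the ball B_n (n ≥ 1):
(i) the cycle of the empty word ε has length exactly 2n + 1;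
(ii) the cycle of a reduced word w of length m with 1 ≤ m ≤ n whose first letter is neither x
nor x⁻¹ has length exactly 4(n − m) + 2. -/
theorem freeGroup_perm_cycle_lengths (s : ℕ) (hs : 2 ≤ s) (n : ℕ) (hn : 1 ≤ n)
    (x : FreeGroup (Fin s)) (hx : x.norm = 1)
    (σ : Equiv.Perm {w : FreeGroup (Fin s) // w.norm ≤ n})
    (hσ : ∀ w : {w : FreeGroup (Fin s) // w.norm ≤ n},
      ((σ w : {w : FreeGroup (Fin s) // w.norm ≤ n}) : FreeGroup (Fin s))
        = pFun x n (w : FreeGroup (Fin s))) :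
    ((σ ^ (2 * n + 1)) (epsBall s n) = epsBall s n ∧
      ∀ j : ℕ, 1 ≤ j → j ≤ 2 * n → (σ ^ j) (epsBall s n) ≠ epsBall s n) ∧
    (∀ w : {w : FreeGroup (Fin s) // w.norm ≤ n},
      1 ≤ (w : FreeGroup (Fin s)).norm →
      (∀ l ∈ ((w : FreeGroup (Fin s)).toWord).head?,
        FreeGroup.mk [l] ≠ x ∧ FreeGroup.mk [l] ≠ x⁻¹) →
      ((σ ^ (4 * (n - (w : FreeGroup (Fin s)).norm) + 2)) w = w ∧
        ∀ j : ℕ, 1 ≤ j → j < 4 * (n - (w : FreeGroup (Fin s)).norm) + 2 →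
          (σ ^ j) w ≠ w)) := by
  refine ⟨?_, ?_⟩
  · have hw : ∀ k : ℤ, (x ^ k * (epsBall s n : FreeGroup (Fin s))).norm =
        k.natAbs + (epsBall s n : FreeGroup (Fin s)).norm :=
      norm_zpow_letter_mul hx (by simp [epsBall])
    have hr : n + (epsBall s n : FreeGroup (Fin s)).norm = n := by simp [epsBall]
    simp only [ne_eq, perm_pow_eq_self_iff hσ _ hw hr]
    refine ⟨?_, fun j hj₁ hj₂ => pFun_iterate_ne_of_le hw hr hj₁ hj₂⟩
    rw [pFun_iterate_half_turn hx hw hr]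
    simp [epsBall, flipWord_one]
  · intro w hw₁ hhead
    have hw := norm_zpow_letter_mul hx hhead
    have hr : n - w.1.norm + w.1.norm = n := Nat.sub_add_cancel w.2
    simp only [ne_eq, perm_pow_eq_self_iff hσ _ hw hr]
    exact ⟨pFun_iterate_full_turn hx hw hr,
      fun j hj₁ hj₂ => pFun_iterate_ne_of_lt hx (by omega) hw hr hj₁ hj₂⟩
end

section
/- Let s ≥ 2, F_s the free group on generators a₁,…,a_s, n ∈ ℕ, B_n the ball of radius n in F_s, and for a letter x ∈ {a₁^{±1},…,a_s^{±1}} let p_x^{(n)} be the permutation of B_n defined by p_x^{(n)}(w) = x·w if |x·w| ≤ n and p_x^{(n)}(w) = w₁⁻¹⋯w_m⁻¹ otherwise (w₁⋯w_m the reduced word of w). Then the number of cycles of p_x^{(n)} of even length equals ((2s − 1)ⁿ − 1)/2, and consequently the sign of the permutation p_x^{(n)} equals (−1)^{n(s−1)}. -/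
namespace FreeGroup

section Words

variable {α : Type*} [DecidableEq α]

theorem toWord_mk_of_isReduced {L : List (α × Bool)} (h : IsReduced L) : (mk L).toWord = L := by
  rw [toWord_mk, h.reduce_eq]

theorem IsReduced.of_cons {α : Type*} {q : α × Bool} {L : List (α × Bool)} (h : IsReduced (q :: L)) :
    IsReduced L :=
  List.IsChain.tail h

theorem isReduced_cons_toWord_or (p : α × Bool) (w : FreeGroup α) :
    IsReduced (p :: w.toWord) ∨ ∃ T, w.toWord = (p.1, !p.2) :: T := by
  have hw : IsReduced w.toWord := isReduced_toWord
  rcases hL : w.toWord with _ | ⟨q, T⟩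
  · simp
  · rw [hL] at hw
    by_cases h : p.1 = q.1 → p.2 = q.2
    · exact Or.inl (isReduced_cons_cons.2 ⟨h, hw⟩)
    · push Not at h
      refine Or.inr ⟨T, ?_⟩
      obtain ⟨h1, h2⟩ := h
      congr 1
      ext
      · exact h1.symm
      · simp [Bool.eq_not.2 h2.symm]

theorem toWord_letter_mul {p : α × Bool} {w : FreeGroup α} (h : IsReduced (p :: w.toWord)) :
    (mk [p] * w).toWord = p :: w.toWord := by
  conv_lhs => rw [← mk_toWord (x := w), mul_mk]
  exact toWord_mk_of_isReduced h

theorem toWord_letter_mul_of_cancel {p : α × Bool} {w : FreeGroup α} {T : List (α × Bool)}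
    (h : w.toWord = (p.1, !p.2) :: T) : (mk [p] * w).toWord = T := by
  have hT : IsReduced T := .of_cons (h ▸ isReduced_toWord (x := w))
  have hw : w = mk ((p.1, !p.2) :: T) := by rw [← h, mk_toWord]
  rw [hw, mul_mk, toWord_mk]
  exact (reduce.Step.eq Red.Step.cons_not).trans hT.reduce_eq

/-- The reduced word of `w` with its leading letters `a ^ (±1)` deleted. -/
def strip (a : α) (w : FreeGroup α) : FreeGroup α :=
  mk (w.toWord.dropWhile fun q => q.1 = a)

theorem toWord_strip (a : α) (w : FreeGroup α) :
    (strip a w).toWord = w.toWord.dropWhile fun q => q.1 = a :=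
  toWord_mk_of_isReduced
    (List.IsChain.suffix isReduced_toWord (List.dropWhile_suffix _))

theorem norm_strip_le (a : α) (w : FreeGroup α) : (strip a w).norm ≤ w.norm := by
  rw [norm, toWord_strip]
  exact (List.dropWhile_suffix _).length_le

theorem strip_strip (a : α) (w : FreeGroup α) : strip a (strip a w) = strip a w := by
  apply toWord_injective
  rw [toWord_strip, toWord_strip, List.dropWhile_idempotent]

theorem strip_letter_mul (p : α × Bool) (w : FreeGroup α) :
    strip p.1 (mk [p] * w) = strip p.1 w := by
  apply toWord_injective
  rw [toWord_strip, toWord_strip]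
  rcases isReduced_cons_toWord_or p w with h | ⟨T, h⟩
  · simp [toWord_letter_mul h]
  · simp [toWord_letter_mul_of_cancel h, h]

theorem ne_of_strip_eq {a : α} {w : FreeGroup α} (hw : strip a w = w) {q : α × Bool}
    {T : List (α × Bool)} (h : w.toWord = q :: T) : q.1 ≠ a := by
  intro hq
  have h1 := toWord_strip a w
  have h2 := (List.dropWhile_suffix (l := T) fun q => q.1 = a).length_le
  rw [hw, h, List.dropWhile_cons_of_pos (by simpa using hq)] at h1
  rw [← h1] at h2
  simp at h2

theorem toWord_letter_pow_mul {p : α × Bool} {w : FreeGroup α} (hw : strip p.1 w = w) (k : ℕ) :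
    (mk [p] ^ k * w).toWord = List.replicate k p ++ w.toWord := by
  induction k with
  | zero => simp
  | succ k ih =>
    rw [pow_succ', mul_assoc, toWord_letter_mul, ih]
    · simp [List.replicate_succ]
    · rcases isReduced_cons_toWord_or p (mk [p] ^ k * w) with h | ⟨T, h⟩
      · exact h
      · exfalso
        rw [ih] at h
        cases k with
        | zero => exact ne_of_strip_eq hw (q := (p.1, !p.2)) (by simpa using h) rfl
        | succ k =>
          simp only [List.replicate_succ, List.cons_append, List.cons.injEq] at h
          simpa using congrArg Prod.snd h.1

theorem norm_letter_pow_mul {p : α × Bool} {w : FreeGroup α} (hw : strip p.1 w = w) (k : ℕ) :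
    (mk [p] ^ k * w).norm = k + w.norm := by
  rw [norm, toWord_letter_pow_mul hw, List.length_append, List.length_replicate, norm]

theorem norm_pow_mul_le {x : FreeGroup α} (hx : x.norm = 1) (k : ℕ) (w : FreeGroup α) :
    (x ^ k * w).norm ≤ k + w.norm := by
  induction k with
  | zero => simp
  | succ k ih =>
    rw [pow_succ', mul_assoc]
    have := norm_mul_le x (x ^ k * w)
    omega

theorem exists_eq_mk_singleton {x : FreeGroup α} (hx : x.norm = 1) : ∃ p, x = mk [p] := by
  obtain ⟨p, hp⟩ := List.length_eq_one_iff.1 hx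
  exact ⟨p, by rw [← hp, mk_toWord]⟩

/-- A word not fixed by `strip` becomes shorter on multiplying it by one of the two letters. -/
theorem norm_letter_mul_lt_or {p : α × Bool} {w : FreeGroup α} (hw : strip p.1 w ≠ w) :
    (mk [p] * w).norm < w.norm ∨ ((mk [p])⁻¹ * w).norm < w.norm := by
  rcases hL : w.toWord with _ | ⟨q, T⟩
  · exact absurd (toWord_injective (by rw [toWord_strip, hL]; rfl)) hw
  · by_cases hq : q.1 = p.1
    · rcases Bool.eq_or_eq_not q.2 p.2 with h2 | h2
      · right
        have : (mk [p])⁻¹ = mk [(p.1, !p.2)] := by simp [inv_mk, invRev]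
        rw [this, norm, toWord_letter_mul_of_cancel (T := T), norm, hL]
        · simp
        · rw [hL, Bool.not_not, ← hq, ← h2]
      · left
        rw [norm, toWord_letter_mul_of_cancel (T := T), norm, hL]
        · simp
        · rw [hL, ← hq, ← h2]
    · refine absurd (toWord_injective ?_) hw
      rw [toWord_strip, hL, List.dropWhile_cons_of_neg (by simpa using hq)]

end Words

section Flip

variable {s : ℕ}

theorem flipWord_eq_lift (w : FreeGroup (Fin s)) :
    flipWord w = lift (fun i => (of i)⁻¹) w := by
  conv_rhs => rw [← mk_toWord (x := w)]
  rw [flipWord]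
  generalize w.toWord = L
  induction L with
  | nil => simp [one_eq_mk]
  | cons q L ih =>
    rw [List.map_cons, ← List.singleton_append, ← mul_mk, ih, ← List.singleton_append (l := L),
      ← mul_mk, _root_.map_mul]
    congr 1
    rcases q with ⟨i, _ | _⟩ <;> simp [lift_mk, of, inv_mk, invRev]

theorem flipWord_mul (v w : FreeGroup (Fin s)) :
    flipWord (v * w) = flipWord v * flipWord w := by
  simp only [flipWord_eq_lift, _root_.map_mul]

theorem flipWord_pow (v : FreeGroup (Fin s)) (k : ℕ) : flipWord (v ^ k) = flipWord v ^ k := by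
  simp only [flipWord_eq_lift, _root_.map_pow]

theorem flipWord_letter (p : Fin s × Bool) : flipWord (mk [p]) = (mk [p])⁻¹ := by
  rw [flipWord, toWord_mk, reduce_singleton]
  simp [inv_mk, invRev]

theorem toWord_flipWord (w : FreeGroup (Fin s)) :
    (flipWord w).toWord = w.toWord.map fun p => (p.1, !p.2) := by
  apply toWord_mk_of_isReduced
  have h : IsReduced w.toWord := isReduced_toWord
  rw [IsReduced, List.isChain_map]
  exact h.imp fun p q hpq h => by rw [hpq h]

theorem norm_flipWord (w : FreeGroup (Fin s)) : (flipWord w).norm = w.norm := by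
  simp [norm, toWord_flipWord]

theorem flipWord_flipWord (w : FreeGroup (Fin s)) : flipWord (flipWord w) = w := by
  apply toWord_injective
  simp [toWord_flipWord, Function.comp_def]

theorem flipWord_eq_self_iff {w : FreeGroup (Fin s)} : flipWord w = w ↔ w = 1 := by
  rw [← toWord_inj, toWord_flipWord, ← toWord_eq_nil_iff]
  rcases w.toWord with _ | ⟨⟨i, _ | _⟩, T⟩ <;> simp

theorem strip_flipWord (a : Fin s) (w : FreeGroup (Fin s)) :
    strip a (flipWord w) = flipWord (strip a w) := by
  apply toWord_injective
  rw [toWord_strip, toWord_flipWord, toWord_flipWord, toWord_strip, List.dropWhile_map]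
  rfl

end Flip

section Count

variable {s : ℕ}

/-- The words `L` of length `n` such that `p :: L` is reduced. -/
def continuations : ℕ → Fin s × Bool → Finset (List (Fin s × Bool))
  | 0, _ => {[]}
  | n + 1, p => ({q | p.1 = q.1 → p.2 = q.2} : Finset (Fin s × Bool)).biUnion fun q =>
      (continuations n q).image (List.cons q)

theorem mem_continuations {n : ℕ} {p : Fin s × Bool} {L : List (Fin s × Bool)} :
    L ∈ continuations n p ↔ L.length = n ∧ IsReduced (p :: L) := by
  induction n generalizing p L with
  | zero =>
    simp only [continuations, Finset.mem_singleton, List.length_eq_zero_iff]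
    exact ⟨fun h => by simp [h], And.left⟩
  | succ n ih =>
    rcases L with _ | ⟨q, T⟩
    · simp [continuations]
    · simp [continuations, ih]
      tauto

theorem card_continuations (n : ℕ) (p : Fin s × Bool) :
    (continuations n p).card = (2 * s - 1) ^ n := by
  induction n generalizing p with
  | zero => simp [continuations]
  | succ n ih =>
    rw [continuations, Finset.card_biUnion]
    · simp only [Finset.card_image_of_injective _ List.cons_injective, ih, Finset.sum_const,
        smul_eq_mul, pow_succ']
      congr 1
      have : ({q | p.1 = q.1 → p.2 = q.2} : Finset (Fin s × Bool)) = {(p.1, !p.2)}ᶜ := by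
        ext ⟨i, c⟩
        rcases p with ⟨j, d⟩
        cases c <;> cases d <;> simp [@eq_comm _ i j]
      rw [this, Finset.card_compl]
      simp [mul_comm]
    · intro q _ r _ hqr
      rw [Function.onFun, Finset.disjoint_left]
      simp only [Finset.mem_image]
      rintro _ ⟨L, -, rfl⟩ ⟨M, -, h⟩
      exact hqr (List.cons.inj h).1.symm

theorem eq_replicate_append_of_isReduced {p : Fin s × Bool} {L : List (Fin s × Bool)}
    (h : IsReduced (p :: L)) :
    ∃ k, L = List.replicate k p ++ L.dropWhile fun q => q.1 = p.1 := by
  induction L with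
  | nil => exact ⟨0, rfl⟩
  | cons q T ih =>
    rw [isReduced_cons_cons] at h
    by_cases hq : q.1 = p.1
    · have hqp : q = p := Prod.ext hq (h.1 hq.symm).symm
      subst hqp
      obtain ⟨k, hk⟩ := ih h.2
      refine ⟨k + 1, ?_⟩
      rw [List.dropWhile_cons_of_pos (by simp), List.replicate_succ, List.cons_append, ← hk]
    · exact ⟨0, by rw [List.dropWhile_cons_of_neg (by simpa using hq)]; rfl⟩

/-- The ball of radius `n` has `(2 s - 1) ^ n` words that do not begin with `a ^ (±1)`. -/
theorem card_strip_eq_self (n : ℕ) (a : Fin s)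
    [Fintype {w : FreeGroup (Fin s) // w.norm ≤ n}] :
    (Finset.univ.filter fun w : {w : FreeGroup (Fin s) // w.norm ≤ n} =>
      strip a w.1 = w.1).card = (2 * s - 1) ^ n := by
  rw [← card_continuations n (a, true)]
  symm
  have hlen : ∀ L ∈ continuations n (a, true), (strip a (mk L)).norm ≤ n := fun L hL =>
    (norm_strip_le _ _).trans (norm_mk_le.trans (mem_continuations.1 hL).1.le)
  have hword : ∀ L ∈ continuations n (a, true),
      (strip a (mk L)).toWord = L.dropWhile fun q => q.1 = a := fun L hL => by
    rw [toWord_strip, toWord_mk_of_isReduced (mem_continuations.1 hL).2.of_cons]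
  refine Finset.card_bij (fun L hL => ⟨strip a (mk L), hlen L hL⟩) ?_ ?_ ?_
  · intro L hL
    simp [strip_strip]
  · intro L hL M hM h
    have h' := congrArg toWord (congrArg Subtype.val h)
    simp only [hword L hL, hword M hM] at h'
    rw [mem_continuations] at hL hM
    obtain ⟨k, hk⟩ := eq_replicate_append_of_isReduced hL.2
    obtain ⟨l, hl⟩ := eq_replicate_append_of_isReduced hM.2
    have hkl : k = l := by
      have h1 := congrArg List.length hk
      have h2 := congrArg List.length hl
      have h3 := congrArg List.length h'
      simp only [List.length_append, List.length_replicate] at h1 h2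
      omega
    rw [hk, hl, hkl]
    simp only
    rw [h']
  · rintro ⟨w, hw⟩ hmem
    have hs : strip a w = w := by simpa using hmem
    have hwd := toWord_letter_pow_mul (p := (a, true)) hs
    refine ⟨List.replicate (n - w.norm) (a, true) ++ w.toWord, ?_, ?_⟩
    · rw [mem_continuations]
      constructor
      · simp only [List.length_append, List.length_replicate]
        exact Nat.sub_add_cancel hw
      · rw [← List.cons_append, ← List.replicate_succ, ← hwd]
        exact isReduced_toWord
    · apply Subtype.ext
      apply toWord_injective
      simp only
      rw [← hwd, mk_toWord, toWord_strip, hwd, List.dropWhile_append_of_pos, ← toWord_strip, hs]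
      simp +contextual [List.mem_replicate]

end Count

end FreeGroup

namespace Equiv.Perm

variable {β : Type*} [Fintype β] [DecidableEq β] {σ : Perm β}

theorem card_support_cycleOf_dvd_iff {u : β} (hu : σ u ≠ u) (k : ℕ) :
    (σ.cycleOf u).support.card ∣ k ↔ (σ ^ k) u = u := by
  have hc := isCycle_cycleOf σ hu
  have hu' : σ.cycleOf u u ≠ u := by rwa [cycleOf_apply_self]
  rw [← hc.orderOf, orderOf_dvd_iff_pow_eq_one, hc.pow_eq_one_iff' hu', cycleOf_pow_apply_self]

theorem even_card_support_cycleOf_iff {u : β} (hu : σ u ≠ u) {L : ℕ} (hL : Odd L)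
    (h : (σ ^ (2 * L)) u = u) :
    Even (σ.cycleOf u).support.card ↔ (σ ^ L) u ≠ u := by
  rw [← card_support_cycleOf_dvd_iff hu] at h
  rw [Ne, ← card_support_cycleOf_dvd_iff hu]
  constructor
  · intro he hd
    exact Nat.not_even_iff_odd.2 (hL.of_dvd_nat hd) he
  · intro hd
    by_contra ho
    rw [Nat.not_even_iff_odd] at ho
    exact hd ((Nat.Coprime.dvd_of_dvd_mul_left ho.coprime_two_right) h)

theorem sign_eq_neg_one_pow_card_filter_even (σ : Perm β) :
    sign σ = (-1 : ℤˣ) ^ (σ.cycleType.filter fun k => Even k).card := by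
  rw [sign_of_cycleType']
  induction σ.cycleType using Multiset.induction_on with
  | empty => simp
  | cons k m ih =>
    rw [Multiset.map_cons, Multiset.prod_cons, ih]
    rcases Nat.even_or_odd k with hk | hk
    · rw [Multiset.filter_cons_of_pos _ hk, Multiset.card_cons, hk.neg_one_pow, pow_succ']
    · rw [Multiset.filter_cons_of_neg _ (Nat.not_even_iff_odd.2 hk), hk.neg_one_pow]
      simp

/-- If an involution `τ` without fixed points on `U` pairs the points of `U` on a common cycle of
`σ`, and the cycles of even length are those meeting `U`, then `U` has twice as many elements as
`σ` has cycles of even length. -/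
theorem two_mul_card_filter_even_cycleType (U : Finset β) (τ : β → β)
    (hτU : ∀ u ∈ U, τ u ∈ U) (hτ : ∀ u ∈ U, τ u ≠ u) (hστ : ∀ u ∈ U, σ.SameCycle u (τ u))
    (hU : ∀ u ∈ U, ∀ v ∈ U, σ.SameCycle u v → v = u ∨ v = τ u)
    (heven : ∀ u ∈ U, Even (σ.cycleOf u).support.card)
    (hex : ∀ w, σ w ≠ w → Even (σ.cycleOf w).support.card → ∃ u ∈ U, σ.SameCycle w u) :
    2 * (σ.cycleType.filter fun k => Even k).card = U.card := by
  have hcard : (σ.cycleType.filter fun k => Even k).card =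
      (σ.cycleFactorsFinset.filter fun c => Even c.support.card).card := by
    rw [cycleType_def, Multiset.filter_map, Multiset.card_map]
    rfl
  have hsupp : ∀ u ∈ U, u ∈ σ.support := fun u hu => by
    rw [mem_support]
    intro h
    exact hτ u hu ((hστ u hu).eq_of_left h).symm
  rw [hcard, Finset.card_eq_sum_card_fiberwise (f := fun u => σ.cycleOf u)
    (t := σ.cycleFactorsFinset.filter fun c => Even c.support.card)]
  · rw [Finset.sum_const_nat (m := 2), mul_comm]
    intro c hc
    rw [Finset.mem_filter] at hc
    obtain ⟨w, hw⟩ := (mem_cycleFactorsFinset_iff.1 hc.1).1.nonempty_support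
    have hcw := cycle_is_cycleOf hw hc.1
    have hwσ : σ w ≠ w := mem_support.1 (mem_cycleFactorsFinset_support_le hc.1 hw)
    obtain ⟨u, hu, hwu⟩ := hex w hwσ (hcw ▸ hc.2)
    rw [hwu.cycleOf_eq] at hcw
    rw [← Finset.card_pair (hτ u hu).symm]
    congr 1
    ext v
    simp only [Finset.mem_filter, Finset.mem_insert, Finset.mem_singleton]
    constructor
    · rintro ⟨hv, hvc⟩
      refine hU u hu v hv ?_
      rw [sameCycle_iff_cycleOf_eq_of_mem_support (hsupp u hu) (hsupp v hv), hvc, hcw]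
    · rintro (rfl | rfl)
      · exact ⟨hu, hcw.symm⟩
      · exact ⟨hτU u hu, by rw [hcw, (hστ u hu).cycleOf_eq]⟩
  · intro u hu
    rw [Finset.mem_coe] at hu
    simp only [Finset.coe_filter, Set.mem_ofPred_eq]
    exact ⟨cycleOf_mem_cycleFactorsFinset_iff.2 (hsupp u hu), heven u hu⟩

end Equiv.Perm

namespace FreeGroup

section Ball

variable {s n : ℕ} {p : Fin s × Bool} {σ : Equiv.Perm {w : FreeGroup (Fin s) // w.norm ≤ n}}

theorem strip_pFun (w : FreeGroup (Fin s)) :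
    strip p.1 (pFun (mk [p]) n w) = strip p.1 w ∨
      strip p.1 (pFun (mk [p]) n w) = flipWord (strip p.1 w) := by
  rw [pFun]
  split_ifs
  · exact Or.inl (strip_letter_mul p w)
  · exact Or.inr (strip_flipWord p.1 w)

theorem coe_pow_apply_of_norm_le (hσ : ∀ w, (σ w).1 = pFun (mk [p]) n w.1)
    (w : {w : FreeGroup (Fin s) // w.norm ≤ n}) {k : ℕ}
    (hk : ∀ i ≤ k, (mk [p] ^ i * w.1).norm ≤ n) : ((σ ^ k) w).1 = mk [p] ^ k * w.1 := by
  induction k with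
  | zero => simp
  | succ k ih =>
    have h := hk (k + 1) le_rfl
    rw [pow_succ', Equiv.Perm.mul_apply, hσ, ih fun i hi => hk i (hi.trans k.le_succ), pFun,
      ← mul_assoc, ← pow_succ', if_pos h]

theorem strip_eq_or_of_sameCycle [Finite {w : FreeGroup (Fin s) // w.norm ≤ n}]
    (hσ : ∀ w, (σ w).1 = pFun (mk [p]) n w.1)
    {v w : {w : FreeGroup (Fin s) // w.norm ≤ n}} (h : σ.SameCycle v w) :
    strip p.1 w.1 = strip p.1 v.1 ∨ strip p.1 w.1 = flipWord (strip p.1 v.1) := by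
  obtain ⟨k, rfl⟩ := h.exists_nat_pow_eq
  clear h
  induction k with
  | zero => simp
  | succ k ih =>
    rw [pow_succ', Equiv.Perm.mul_apply, hσ]
    rcases strip_pFun (n := n) (p := p) ((σ ^ k) v).1 with h | h <;> rw [h] <;>
      rcases ih with ih | ih <;> simp [ih, flipWord_flipWord]

theorem exists_sameCycle_strip (hσ : ∀ w, (σ w).1 = pFun (mk [p]) n w.1)
    (w : {w : FreeGroup (Fin s) // w.norm ≤ n}) :
    σ.SameCycle w ⟨strip p.1 w.1, (norm_strip_le _ _).trans w.2⟩ := by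
  obtain ⟨w, hw⟩ := w
  obtain ⟨m, hm⟩ : ∃ m, w.norm = m := ⟨_, rfl⟩
  induction m using Nat.strong_induction_on generalizing w with
  | _ m ih =>
    by_cases hs : strip p.1 w = w
    · exact Eq.sameCycle (Subtype.ext hs.symm) σ
    · rcases norm_letter_mul_lt_or hs with h | h
      · have hle : (mk [p] * w).norm ≤ n := h.le.trans hw
        have hstep : σ ⟨w, hw⟩ = ⟨mk [p] * w, hle⟩ := Subtype.ext (by rw [hσ, pFun, if_pos hle])
        have := ih _ (hm ▸ h) _ hle rfl
        simp only [strip_letter_mul] at this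
        exact (Equiv.Perm.sameCycle_apply_right.2 .rfl).trans (hstep.sameCycle σ) |>.trans this
      · have hle : ((mk [p])⁻¹ * w).norm ≤ n := h.le.trans hw
        have hstep : σ ⟨(mk [p])⁻¹ * w, hle⟩ = ⟨w, hw⟩ :=
          Subtype.ext (by rw [hσ, pFun]; simp only [mul_inv_cancel_left, if_pos hw])
        have := ih _ (hm ▸ h) _ hle rfl
        have hst := strip_letter_mul p ((mk [p])⁻¹ * w)
        rw [mul_inv_cancel_left] at hst
        simp only [← hst] at this
        exact (hstep.symm.sameCycle σ).trans (Equiv.Perm.sameCycle_apply_left.2 .rfl) |>.trans this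

/-- Starting from a word `u` that does not begin with `x ^ (±1)`, the permutation reaches the
letterwise inverse of `u` after going once along the line of words `x ^ k * u`. -/
theorem coe_pow_apply_of_strip_eq (hσ : ∀ w, (σ w).1 = pFun (mk [p]) n w.1)
    {u : {w : FreeGroup (Fin s) // w.norm ≤ n}} (hu : strip p.1 u.1 = u.1) :
    ((σ ^ (2 * (n - u.1.norm) + 1)) u).1 = flipWord u.1 := by
  have hun := u.2
  set m := n - u.1.norm with hm
  have h1 : ((σ ^ m) u).1 = mk [p] ^ m * u.1 := coe_pow_apply_of_norm_le hσ u fun i hi => by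
    rw [norm_letter_pow_mul hu]
    omega
  have h2 : ((σ ^ (m + 1)) u).1 = (mk [p])⁻¹ ^ m * flipWord u.1 := by
    rw [pow_succ', Equiv.Perm.mul_apply, hσ, h1, pFun, ← mul_assoc, ← pow_succ',
      norm_letter_pow_mul hu, if_neg (by omega), flipWord_mul, flipWord_pow, flipWord_letter]
  have h3 : 2 * m + 1 = m + (m + 1) := by ring
  rw [h3, pow_add, Equiv.Perm.mul_apply, coe_pow_apply_of_norm_le hσ, h2]
  · rw [inv_pow, mul_inv_cancel_left]
  · intro i hi
    have h4 : mk [p] ^ i * ((mk [p])⁻¹ ^ m * flipWord u.1) =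
        (mk [p])⁻¹ ^ (m - i) * flipWord u.1 := by
      obtain ⟨j, hj⟩ := Nat.exists_eq_add_of_le hi
      rw [hj, Nat.add_sub_cancel_left, pow_add, mul_assoc, inv_pow _ i, mul_inv_cancel_left]
    have h5 : ((mk [p])⁻¹).norm = 1 := by rw [norm_inv_eq]; rfl
    rw [h2, h4]
    refine (norm_pow_mul_le h5 _ _).trans ?_
    rw [norm_flipWord]
    omega

theorem pow_two_mul_apply_of_strip_eq (hσ : ∀ w, (σ w).1 = pFun (mk [p]) n w.1)
    {u : {w : FreeGroup (Fin s) // w.norm ≤ n}} (hu : strip p.1 u.1 = u.1) :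
    (σ ^ (2 * (2 * (n - u.1.norm) + 1))) u = u := by
  have h1 := coe_pow_apply_of_strip_eq hσ hu
  apply Subtype.ext
  have h2 := coe_pow_apply_of_strip_eq (u := (σ ^ (2 * (n - u.1.norm) + 1)) u) hσ
    (by rw [h1, strip_flipWord, hu])
  rw [h1, norm_flipWord, flipWord_flipWord] at h2
  rw [two_mul, pow_add, Equiv.Perm.mul_apply, h2]

theorem two_mul_card_even_cycles [Fintype {w : FreeGroup (Fin s) // w.norm ≤ n}]
    (hσ : ∀ w, (σ w).1 = pFun (mk [p]) n w.1) :
    2 * (σ.cycleType.filter fun k => Even k).card = (2 * s - 1) ^ n - 1 := by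
  have hone : strip p.1 (1 : FreeGroup (Fin s)) = 1 := by simp [strip, one_eq_mk]
  rw [← card_strip_eq_self n p.1, ← Finset.card_erase_of_mem (a := ⟨1, by simp⟩) (by simpa)]
  have hmem : ∀ u : {w : FreeGroup (Fin s) // w.norm ≤ n},
      u ∈ (Finset.univ.filter fun w : {w : FreeGroup (Fin s) // w.norm ≤ n} =>
        strip p.1 w.1 = w.1).erase ⟨1, by simp⟩ ↔ u.1 ≠ 1 ∧ strip p.1 u.1 = u.1 := by
    intro u
    simp [Subtype.ext_iff]
  have hflip : ∀ u : {w : FreeGroup (Fin s) // w.norm ≤ n}, (flipWord u.1).norm ≤ n := fun u => by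
    rw [norm_flipWord]
    exact u.2
  have hodd : ∀ k, Odd (2 * k + 1) := odd_two_mul_add_one
  have hsame : ∀ u : {w : FreeGroup (Fin s) // w.norm ≤ n}, strip p.1 u.1 = u.1 →
      σ.SameCycle u ⟨flipWord u.1, hflip u⟩ := fun u hu =>
    ⟨(2 * (n - u.1.norm) + 1 : ℕ), Subtype.ext (by
      rw [zpow_natCast]; exact coe_pow_apply_of_strip_eq hσ hu)⟩
  have hne : ∀ u : {w : FreeGroup (Fin s) // w.norm ≤ n}, u.1 ≠ 1 →
      (⟨flipWord u.1, hflip u⟩ : {w : FreeGroup (Fin s) // w.norm ≤ n}) ≠ u := fun u hu h =>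
    hu (flipWord_eq_self_iff.1 (congrArg Subtype.val h))
  have heven : ∀ u : {w : FreeGroup (Fin s) // w.norm ≤ n}, strip p.1 u.1 = u.1 → σ u ≠ u →
      (Even (σ.cycleOf u).support.card ↔ u.1 ≠ 1) := fun u hu hσu => by
    rw [Equiv.Perm.even_card_support_cycleOf_iff hσu (hodd _) (pow_two_mul_apply_of_strip_eq hσ hu),
      Ne, Subtype.ext_iff, coe_pow_apply_of_strip_eq hσ hu, flipWord_eq_self_iff]
  apply Equiv.Perm.two_mul_card_filter_even_cycleType _ fun u => ⟨flipWord u.1, hflip u⟩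
  · intro u hu
    rw [hmem] at hu ⊢
    refine ⟨fun h => hu.1 ?_, by rw [strip_flipWord, hu.2]⟩
    rw [← norm_eq_zero, ← norm_flipWord, norm_eq_zero]
    exact h
  · exact fun u hu => hne u ((hmem u).1 hu).1
  · exact fun u hu => hsame u ((hmem u).1 hu).2
  · intro u hu v hv h
    rw [hmem] at hu hv
    simpa only [hu.2, hv.2, Subtype.ext_iff] using strip_eq_or_of_sameCycle hσ h
  · intro u hu
    rw [hmem] at hu
    refine (heven u hu.2 fun h => ?_).2 hu.1
    exact hne u hu.1 ((hsame u hu.2).eq_of_left h).symm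
  · intro w hw he
    have h := exists_sameCycle_strip hσ w
    refine ⟨_, (hmem _).2 ⟨?_, strip_strip _ _⟩, h⟩
    rw [h.cycleOf_eq] at he
    exact (heven _ (strip_strip _ _) fun hfix => hw (h.apply_eq_self_iff.2 hfix)).1 he

end Ball

end FreeGroup

theorem neg_one_pow_eq_of_two_mul_eq {s n k : ℕ} (hs : 1 ≤ s) (h : 2 * k = (2 * s - 1) ^ n - 1) :
    (-1 : ℤˣ) ^ k = (-1 : ℤˣ) ^ (n * (s - 1)) := by
  obtain ⟨t, rfl⟩ := Nat.exists_eq_add_of_le' hs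
  have hpow : ∀ n : ℕ, (2 * t + 1) ^ n ≡ 2 * (n * t) + 1 [MOD 4] := by
    intro n
    induction n with
    | zero => simpa using Nat.ModEq.refl 1
    | succ n ih =>
      rw [pow_succ]
      refine (ih.mul_right _).trans ?_
      have : (2 * (n * t) + 1) * (2 * t + 1) = 2 * ((n + 1) * t) + 1 + 4 * (n * t * t) := by ring
      rw [this]
      simp [Nat.ModEq]
  have h1 : 2 * (t + 1) - 1 = 2 * t + 1 := by omega
  rw [h1] at h
  have hpos : 0 < (2 * t + 1) ^ n := by positivity
  have h2 : (2 * t + 1) ^ n = 2 * k + 1 := by omega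
  have h3 := hpow n
  rw [h2] at h3
  have h4 : k % 2 = (n * t) % 2 := by
    unfold Nat.ModEq at h3
    omega
  rw [Nat.add_sub_cancel, Int.units_pow_eq_pow_mod_two, h4, ← Int.units_pow_eq_pow_mod_two]

/-- for a letter x, the permutation p_x^{(n)} of the ball B_n has exactly
((2s − 1)ⁿ − 1)/2 cycles of even length, and hence its sign is (−1)^{n(s−1)}. -/
theorem freeGroup_perm_sign (s : ℕ) (hs : 2 ≤ s) (n : ℕ)
    [Fintype {w : FreeGroup (Fin s) // w.norm ≤ n}]
    (x : FreeGroup (Fin s)) (hx : x.norm = 1)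
    (σ : Equiv.Perm {w : FreeGroup (Fin s) // w.norm ≤ n})
    (hσ : ∀ w : {w : FreeGroup (Fin s) // w.norm ≤ n},
      ((σ w : {w : FreeGroup (Fin s) // w.norm ≤ n}) : FreeGroup (Fin s))
        = pFun x n (w : FreeGroup (Fin s))) :
    2 * (Multiset.filter (fun k => Even k) σ.cycleType).card = (2 * s - 1) ^ n - 1 ∧
    Equiv.Perm.sign σ = (-1 : ℤˣ) ^ (n * (s - 1)) := by
  obtain ⟨p, rfl⟩ := FreeGroup.exists_eq_mk_singleton hx
  have h := FreeGroup.two_mul_card_even_cycles hσ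
  refine ⟨h, ?_⟩
  rw [Equiv.Perm.sign_eq_neg_one_pow_card_filter_even]
  exact neg_one_pow_eq_of_two_mul_eq (by omega) h
end
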